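/- Let γ > 0, let n ≥ 1 and let τ₁, …, τₙ > 0 and ω > 0. Let f : ℝⁿ → ℝ be locally Lipschitz continuous, and let g : ℝ × [0,1] → ℝ be Hölder continuous with g(t+ω, x) = g(t, x) for all t ∈ ℝ, x ∈ [0,1]. Assume (H1): there exist constants β₁, …, βₙ > 0 and K > 0 such that |f(ξ₁,…,ξₙ) + g(t,x)| ≤ Σ_{k=1}^n βₖ|ξₖ| + K for all t ∈ ℝ, x ∈ [0,1], (ξ₁,…,ξₙ) ∈ ℝⁿ; and (H2): Σ_{k=1}^n βₖ < γπ⁴ + π² − 1. Then there exists a function u : ℝ × [0,1] → ℝ such that: u is continuous, u(t+ω, x) = u(t, x) for all t, x; the partial derivatives ∂ₜu, ∂ₓu, ∂ₓ²u, ∂ₓ³u, ∂ₓ⁴u exist and are continuous on ℝ × (0,1) with ∂ₓ²u extending continuously to ℝ × [0,1]; u satisfies ∂ₜu(t,x) + γ ∂ₓ⁴u(t,x) − ∂ₓ²u(t,x) − u(t,x) = g(t,x) + f(u(t−τ₁,x), …, u(t−τₙ,x)) for all (t,x) ∈ ℝ × (0,1); and u(t,0) = u(t,1) = 0 and ∂ₓ²u(t,0)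 = ∂ₓ²u(t,1) = 0 for all t ∈ ℝ. -/

import Mathlib

open Real Set Filter Topology

/-- Time partial derivative of `u : ℝ → ℝ → ℝ` (first variable = time). -/
noncomputable def dt (u : ℝ → ℝ → ℝ) (t x : ℝ) : ℝ := deriv (fun s => u s x) t

/-- `k`-th spatial partial derivative of `u : ℝ → ℝ → ℝ` (second variable = space). -/
noncomputable def dx (k : ℕ) (u : ℝ → ℝ → ℝ) (t x : ℝ) : ℝ := iteratedDeriv k (u t) x

/-- `u` is a time `ω`-periodic classical solution of the delayed extended
Fisher–Kolmogorov equation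
`∂ₜu + γ ∂ₓ⁴u − ∂ₓ²u − u = g(t,x) + f(u(t−τ₁,x),…,u(t−τₙ,x))` on `ℝ × (0,1)`
with Navier boundary conditions. -/
def IsPeriodicClassicalSolution (γ ω : ℝ) {n : ℕ} (τ : Fin n → ℝ)
    (f : (Fin n → ℝ) → ℝ) (g : ℝ → ℝ → ℝ) (u : ℝ → ℝ → ℝ) : Prop :=
  -- u is continuous on ℝ × [0,1]
  ContinuousOn (fun p : ℝ × ℝ => u p.1 p.2) (univ ×ˢ Icc 0 1) ∧
  -- u is ω-periodic in time
  (∀ t x, u (t + ω) x = u t x) ∧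
  -- ∂ₜu exists on ℝ × (0,1)
  (∀ t : ℝ, ∀ x ∈ Ioo (0:ℝ) 1, DifferentiableAt ℝ (fun s => u s x) t) ∧
  -- ∂ₓu, ∂ₓ²u, ∂ₓ³u, ∂ₓ⁴u exist on ℝ × (0,1)
  (∀ t : ℝ, ∀ x ∈ Ioo (0:ℝ) 1, ∀ k < 4, DifferentiableAt ℝ (iteratedDeriv k (u t)) x) ∧
  -- ∂ₜu is continuous on ℝ × (0,1)
  ContinuousOn (fun p : ℝ × ℝ => dt u p.1 p.2) (univ ×ˢ Ioo 0 1) ∧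
  -- the spatial derivatives up to order 4 are continuous on ℝ × (0,1)
  (∀ k ≤ 4, ContinuousOn (fun p : ℝ × ℝ => dx k u p.1 p.2) (univ ×ˢ Ioo 0 1)) ∧
  -- ∂ₓ²u extends continuously to ℝ × [0,1]
  ContinuousOn (fun p : ℝ × ℝ => dx 2 u p.1 p.2) (univ ×ˢ Icc 0 1) ∧
  -- the delayed EFK equation holds on ℝ × (0,1)
  (∀ t : ℝ, ∀ x ∈ Ioo (0:ℝ) 1,
    dt u t x + γ * dx 4 u t x - dx 2 u t x - u t x
      = g t x + f (fun k => u (t - τ k) x)) ∧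
  -- Navier boundary conditions
  (∀ t : ℝ, u t 0 = 0 ∧ u t 1 = 0 ∧ dx 2 u t 0 = 0 ∧ dx 2 u t 1 = 0)

/-- The integral of `det (1 + t • A x)` over a compact set is a polynomial in `t`. -/
theorem exists_polynomial_setIntegral_det {n : ℕ} {K : Set (EuclideanSpace ℝ (Fin n))}
    (hK : IsCompact K)
    {A : EuclideanSpace ℝ (Fin n) → EuclideanSpace ℝ (Fin n) →L[ℝ] EuclideanSpace ℝ (Fin n)}
    (hA : Continuous A) :
    ∃ p : Polynomial ℝ, ∀ t : ℝ, ∫ x in K, (1 + t • A x).det = p.eval t := by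
  classical
  let b := (EuclideanSpace.basisFun (Fin n) ℝ).toBasis
  let M : EuclideanSpace ℝ (Fin n) → Matrix (Fin n) (Fin n) ℝ := fun x =>
    LinearMap.toMatrix b b (A x : EuclideanSpace ℝ (Fin n) →ₗ[ℝ] EuclideanSpace ℝ (Fin n))
  have hM : ∀ i j, Continuous fun x => M x i j := by
    intro i j
    simp only [M, LinearMap.toMatrix_apply, b]
    simp
    fun_prop
  have hdet : ∀ t x, (1 + t • A x).det =
      ∑ σ : Equiv.Perm (Fin n), ∑ s ∈ (Finset.univ : Finset (Fin n)).powerset,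
        t ^ (Finset.univ \ s).card * ((Equiv.Perm.sign σ : ℤ) *
          ((∏ i ∈ s, (1 : Matrix (Fin n) (Fin n) ℝ) (σ i) i) *
            ∏ i ∈ Finset.univ \ s, M x (σ i) i)) := by
    intro t x
    have h1 : (1 + t • A x).det = (1 + t • M x).det := by
      rw [ContinuousLinearMap.det, ← LinearMap.det_toMatrix b]
      congr 1
      simp [M, map_add, map_smul]
    rw [h1, Matrix.det_apply']
    refine Finset.sum_congr rfl fun σ _ => ?_
    simp only [Matrix.add_apply, Matrix.smul_apply, smul_eq_mul]
    rw [Finset.prod_add, Finset.mul_sum]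
    refine Finset.sum_congr rfl fun s _ => ?_
    rw [Finset.prod_mul_distrib, Finset.prod_const]
    ring
  refine ⟨∑ σ : Equiv.Perm (Fin n), ∑ s ∈ (Finset.univ : Finset (Fin n)).powerset,
    Polynomial.C (∫ x in K, ((Equiv.Perm.sign σ : ℤ) *
          ((∏ i ∈ s, (1 : Matrix (Fin n) (Fin n) ℝ) (σ i) i) *
            ∏ i ∈ Finset.univ \ s, M x (σ i) i))) * Polynomial.X ^ (Finset.univ \ s).card,
    fun t => ?_⟩
  have hInt : ∀ (σ : Equiv.Perm (Fin n)) (s : Finset (Fin n)),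
      MeasureTheory.IntegrableOn (fun x => t ^ (Finset.univ \ s).card *
        ((Equiv.Perm.sign σ : ℤ) *
          ((∏ i ∈ s, (1 : Matrix (Fin n) (Fin n) ℝ) (σ i) i) *
            ∏ i ∈ Finset.univ \ s, M x (σ i) i))) K := by
    intro σ s
    refine ContinuousOn.integrableOn_compact hK (Continuous.continuousOn ?_)
    fun_prop
  simp_rw [hdet]
  rw [MeasureTheory.integral_finsetSum _ fun σ _ =>
    MeasureTheory.integrable_finsetSum _ fun s _ => hInt σ s]
  rw [Polynomial.eval_finsetSum]
  refine Finset.sum_congr rfl fun σ _ => ?_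
  rw [MeasureTheory.integral_finsetSum _ fun s _ => hInt σ s, Polynomial.eval_finsetSum]
  refine Finset.sum_congr rfl fun s _ => ?_
  rw [MeasureTheory.integral_const_mul, Polynomial.eval_mul, Polynomial.eval_C,
    Polynomial.eval_pow, Polynomial.eval_X, mul_comm]

/-- A map on a closed ball that vanishes on the sphere, extended by zero, keeps its Lipschitz
constant. -/
theorem lipschitz_indicator_closedBall {E F : Type*} [NormedAddCommGroup E] [NormedSpace ℝ E]
    [NormedAddCommGroup F] {R : ℝ} {L : NNReal} {k : E → F}
    (hk : LipschitzOnWith L k (Metric.closedBall 0 R)) (h0 : ∀ x, ‖x‖ = R → k x = 0) :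
    LipschitzWith L ((Metric.closedBall (0 : E) R).indicator k) := by
  have key : ∀ x y : E, ‖x‖ ≤ R → R < ‖y‖ → ‖k x‖ ≤ L * dist x y := by
    intro x y hx hy
    have hc : ContinuousOn (fun s : ℝ => ‖x + s • (y - x)‖) (Icc 0 1) := by fun_prop
    obtain ⟨s, hs, hs'⟩ := intermediate_value_Icc zero_le_one hc
      (show R ∈ Icc _ _ by constructor <;> simp <;> linarith)
    simp only at hs'
    have h := hk.dist_le_mul x (by simpa using hx) (x + s • (y - x)) (by simp [hs'])
    rw [h0 _ hs', dist_zero_right] at h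
    refine h.trans (mul_le_mul_of_nonneg_left ?_ L.2)
    rw [dist_eq_norm, dist_eq_norm]
    simp only [sub_add_cancel_left, norm_neg, norm_smul, Real.norm_eq_abs, abs_of_nonneg hs.1]
    rw [norm_sub_rev y x]
    exact mul_le_of_le_one_left (norm_nonneg _) hs.2
  refine LipschitzWith.of_dist_le_mul fun x y => ?_
  by_cases hx : ‖x‖ ≤ R <;> by_cases hy : ‖y‖ ≤ R
  · rw [indicator_of_mem (by simpa using hx), indicator_of_mem (by simpa using hy)]
    exact hk.dist_le_mul x (by simpa using hx) y (by simpa using hy)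
  · rw [indicator_of_mem (by simpa using hx), indicator_of_notMem (by simpa using hy),
      dist_zero_right]
    exact key x y hx (not_le.1 hy)
  · rw [indicator_of_notMem (by simpa using hx), indicator_of_mem (by simpa using hy),
      dist_zero_left, dist_comm]
    exact key y x hy (not_le.1 hx)
  · rw [indicator_of_notMem (by simpa using hx), indicator_of_notMem (by simpa using hy), dist_self]
    positivity

/-- A perturbation of the identity by a strict contraction is bijective. -/
theorem bijective_id_add_of_lipschitz {E : Type*} [NormedAddCommGroup E] [CompleteSpace E]
    {L : NNReal} (hL : L < 1) {k : E → E} (hk : LipschitzWith L k) :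
    Function.Bijective fun x => x + k x := by
  constructor
  · intro x y hxy
    have h := hk.dist_le_mul x y
    have hL' : (L : ℝ) < 1 := hL
    have h2 : dist x y = dist (k x) (k y) := by
      simp only at hxy
      rw [dist_eq_norm, dist_eq_norm, ← norm_neg (k x - k y)]
      congr 1
      rw [neg_sub, sub_eq_sub_iff_add_eq_add, hxy, add_comm]
    rw [← h2] at h
    have : dist x y = 0 := by nlinarith [dist_nonneg (x := x) (y := y)]
    exact dist_eq_zero.1 this
  · intro y
    have hc : ContractingWith L fun x => y - k x := by
      refine ⟨hL, LipschitzWith.of_dist_le_mul fun a b => ?_⟩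
      rw [dist_sub_left]
      exact hk.dist_le_mul a b
    have : Nonempty E := ⟨y⟩
    refine ⟨hc.fixedPoint, ?_⟩
    have h : y - k hc.fixedPoint = hc.fixedPoint := hc.fixedPoint_isFixedPt
    simp only
    nth_rewrite 1 [← h]
    abel

/-- No `C¹` map into a sphere restricts to the identity on that sphere. -/
theorem not_exists_contDiff_retraction {n : ℕ} {R : ℝ} (hR : 0 < R)
    {r : EuclideanSpace ℝ (Fin n) → EuclideanSpace ℝ (Fin n)} (hr : ContDiff ℝ 1 r)
    (hS : ∀ x, ‖r x‖ = R) (hfix : ∀ x, ‖x‖ = R → r x = x) : False := by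
  set B := Metric.closedBall (0 : EuclideanSpace ℝ (Fin n)) R with hB
  have hBc : IsCompact B := isCompact_closedBall _ _
  have hBconv : Convex ℝ B := convex_closedBall _ _
  set A : EuclideanSpace ℝ (Fin n) → EuclideanSpace ℝ (Fin n) →L[ℝ] EuclideanSpace ℝ (Fin n) :=
    fun x => fderiv ℝ r x - 1 with hAdef
  have hA : Continuous A := (hr.continuous_fderiv one_ne_zero).sub continuous_const
  have hk : ∀ x, HasFDerivAt (fun y => r y - y) (A x) x := fun x =>
    ((hr.differentiable one_ne_zero) x).hasFDerivAt.sub (hasFDerivAt_id x)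
  obtain ⟨p, hp⟩ := exists_polynomial_setIntegral_det hBc hA
  obtain ⟨L, hL⟩ : ∃ L : NNReal, ∀ x ∈ B, ‖A x‖₊ ≤ L := by
    obtain ⟨L, hL⟩ := (hBc.image (continuous_nnnorm.comp hA)).bddAbove
    exact ⟨L, fun x hx => hL ⟨x, hx, rfl⟩⟩
  have hkL : LipschitzOnWith L (fun y => r y - y) B :=
    hBconv.lipschitzOnWith_of_nnnorm_hasFDerivWithin_le
      (fun x _ => (hk x).hasFDerivWithinAt) hL
  set k := B.indicator (fun y => r y - y) with hkdef
  have hkLip : LipschitzWith L k := lipschitz_indicator_closedBall hkL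
    fun x hx => by simp [hfix x hx]
  obtain ⟨δ, hδ, hdet⟩ : ∃ δ > 0, ∀ T : EuclideanSpace ℝ (Fin n) →L[ℝ] EuclideanSpace ℝ (Fin n),
      ‖T - 1‖ < δ → 0 < T.det := by
    have h1 : (0 : ℝ) < (1 : EuclideanSpace ℝ (Fin n) →L[ℝ] EuclideanSpace ℝ (Fin n)).det := by
      simp [ContinuousLinearMap.det]
    obtain ⟨δ, hδ, h⟩ := Metric.eventually_nhds_iff.1
      (ContinuousLinearMap.continuous_det.continuousAt.eventually (lt_mem_nhds h1))
    exact ⟨δ, hδ, fun T hT => h (by rwa [dist_eq_norm])⟩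
  have hconst : ∀ t : ℝ, 0 ≤ t → t * L < 1 → t * L < δ →
      p.eval t = (MeasureTheory.volume B).toReal := by
    intro t ht h1 h2
    have hbij : Function.Bijective fun x => x + t • k x := by
      refine bijective_id_add_of_lipschitz (L := t.toNNReal * L) ?_ ?_
      · rw [← NNReal.coe_lt_coe, NNReal.coe_mul, Real.coe_toNNReal t ht]
        exact h1
      refine LipschitzWith.of_dist_le_mul fun x y => ?_
      rw [dist_smul₀, Real.norm_eq_abs, abs_of_nonneg ht, NNReal.coe_mul,
        Real.coe_toNNReal t ht, mul_assoc]
      exact mul_le_mul_of_nonneg_left (hkLip.dist_le_mul x y) ht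
    have hout : ∀ x, x ∉ B → x + t • k x = x := fun x hx => by
      simp [hkdef, indicator_of_notMem hx]
    have hin : ∀ x ∈ B, x + t • k x = x + t • (r x - x) := fun x hx => by
      simp [hkdef, indicator_of_mem hx]
    have himg : (fun x => x + t • (r x - x)) '' B = B := by
      ext y
      constructor
      · rintro ⟨x, hx, rfl⟩
        by_contra hy
        have h3 := hout _ hy
        have h4 : x + t • (r x - x) = x := hbij.1 (by simp only; rw [h3, hin x hx])
        exact hy (by simpa [h4] using hx)
      · intro hy
        obtain ⟨x, hx⟩ := hbij.2 y
        simp only at hx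
        have hxB : x ∈ B := by
          by_contra hxB
          rw [hout x hxB] at hx
          exact hxB (hx ▸ hy)
        exact ⟨x, hxB, by simp only; rw [← hin x hxB, hx]⟩
    have hinj : InjOn (fun x => x + t • (r x - x)) B := by
      intro x hx y hy hxy
      refine hbij.1 ?_
      simp only at hxy ⊢
      rw [hin x hx, hin y hy, hxy]
    have hcv := MeasureTheory.integral_image_eq_integral_abs_det_fderiv_smul
      MeasureTheory.volume hBc.measurableSet (f' := fun x => 1 + t • A x)
      (fun x _ => ((hasFDerivAt_id x).add ((hk x).const_smul t)).hasFDerivWithinAt) hinj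
      (fun _ => (1 : ℝ))
    rw [← hp t]
    have h5 : ∫ x in B, (1 + t • A x).det = ∫ x in B, |(1 + t • A x).det| • (1 : ℝ) := by
      refine MeasureTheory.setIntegral_congr_fun hBc.measurableSet fun x hx => ?_
      have : 0 < (1 + t • A x).det := by
        refine hdet _ ?_
        rw [add_sub_cancel_left, norm_smul, Real.norm_eq_abs, abs_of_nonneg ht]
        refine lt_of_le_of_lt (mul_le_mul_of_nonneg_left ?_ ht) h2
        exact_mod_cast hL x hx
      simp [abs_of_pos this]
    rw [h5, ← hcv]
    erw [himg]
    simp [MeasureTheory.Measure.real]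
  have hp1 : p = Polynomial.C (MeasureTheory.volume B).toReal := by
    refine Polynomial.eq_of_infinite_eval_eq _ _ ?_
    obtain ⟨ε, hε, hε1, hε2⟩ : ∃ ε > 0, ε * (L : ℝ) < 1 ∧ ε * (L : ℝ) < δ := by
      have hpos : (0 : ℝ) < L + 1 := by positivity
      refine ⟨min 1 δ / (L + 1), by positivity, ?_, ?_⟩ <;>
      · rw [div_mul_eq_mul_div, div_lt_iff₀ hpos]
        have := min_le_left 1 δ
        have := min_le_right 1 δ
        have : 0 < min 1 δ := by positivity
        nlinarith [L.2]
    refine (Icc_infinite hε).mono fun t ht => ?_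
    have htL : t * (L : ℝ) ≤ ε * L := mul_le_mul_of_nonneg_right ht.2 L.2
    simpa using hconst t ht.1 (htL.trans_lt hε1) (htL.trans_lt hε2)
  have hzero : p.eval 1 = 0 := by
    rw [← hp 1]
    refine MeasureTheory.setIntegral_eq_zero_of_forall_eq_zero fun x _ => ?_
    have hTr : (1 + (1 : ℝ) • A x) = fderiv ℝ r x := by simp [hAdef]
    rw [hTr]
    by_contra hne
    have hdr : HasFDerivAt r (fderiv ℝ r x) x :=
      ((hr.differentiable one_ne_zero) x).hasFDerivAt
    have hsq := hdr.norm_sq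
    have hsq' : HasFDerivAt (fun y => ‖r y‖ ^ 2)
        (0 : EuclideanSpace ℝ (Fin n) →L[ℝ] ℝ) x := by
      simp_rw [hS]; exact hasFDerivAt_const _ _
    have huniq := hsq.unique hsq'
    have hsurj : Function.Surjective (fderiv ℝ r x) := by
      have := (LinearMap.equivOfDetNeZero
        (fderiv ℝ r x : EuclideanSpace ℝ (Fin n) →ₗ[ℝ] EuclideanSpace ℝ (Fin n)) hne).surjective
      exact this
    obtain ⟨v, hv⟩ := hsurj (r x)
    have := DFunLike.congr_fun huniq v
    simp [hv] at this
    have h7 := hS x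
    simp [this] at h7
    exact hR.ne h7
  rw [hp1, Polynomial.eval_C] at hzero
  have hvol : 0 < MeasureTheory.volume B := Metric.measure_closedBall_pos _ _ hR
  exact (ENNReal.toReal_pos hvol.ne' hBc.measure_lt_top.ne).ne' hzero

/-- **Brouwer's fixed point theorem** for bounded continuous self-maps of Euclidean space. -/
theorem exists_fixedPoint_of_continuous_of_bounded {n : ℕ}
    {F : EuclideanSpace ℝ (Fin n) → EuclideanSpace ℝ (Fin n)} (hF : Continuous F) {M : ℝ}
    (hM : ∀ x, ‖F x‖ ≤ M) : ∃ x, F x = x := by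
  by_contra! hne
  have hM0 : 0 ≤ M := (norm_nonneg _).trans (hM 0)
  obtain ⟨P, hP, hPF, -⟩ := hF.exists_contDiff_approx 1
    (ε := fun x => min 1 (‖F x - x‖ / 2)) (by fun_prop)
    (fun x => lt_min one_pos (half_pos (norm_pos_iff.2 (sub_ne_zero.2 (hne x)))))
  have hPM : ∀ x, ‖P x‖ ≤ M + 1 := fun x => by
    have h1 := (hPF x).trans_le (min_le_left _ _)
    rw [dist_eq_norm] at h1
    have h2 := norm_le_norm_add_norm_sub' (P x) (F x)
    linarith [hM x]
  have hPne : ∀ x, P x ≠ x := fun x hx => by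
    have h1 := (hPF x).trans_le (min_le_right _ _)
    rw [hx, dist_comm, dist_eq_norm] at h1
    linarith [norm_nonneg (F x - x)]
  let χ : ContDiffBump (0 : EuclideanSpace ℝ (Fin n)) := ⟨M + 2, M + 3, by linarith, by linarith⟩
  set G := fun x => x - χ x • P x with hG
  have hGc : ContDiff ℝ 1 G := contDiff_id.sub (χ.contDiff.smul hP)
  have hG0 : ∀ x, G x ≠ 0 := by
    intro x hx
    rw [hG] at hx
    simp only [sub_eq_zero] at hx
    by_cases hxM : ‖x‖ ≤ M + 2
    · rw [χ.one_of_mem_closedBall (by simpa using hxM), one_smul] at hx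
      exact hPne x hx.symm
    · have h1 : ‖χ x • P x‖ ≤ 1 * (M + 1) := by
        rw [norm_smul, Real.norm_eq_abs, abs_of_nonneg χ.nonneg]
        exact mul_le_mul χ.le_one (hPM x) (norm_nonneg _) zero_le_one
      rw [← hx] at h1
      linarith
  refine not_exists_contDiff_retraction (R := M + 3) (by linarith)
    (r := fun x => (M + 3) • (‖G x‖⁻¹ • G x)) ?_ ?_ ?_
  · have h1 : ContDiff ℝ 1 fun x => ‖G x‖⁻¹ :=
      (hGc.norm ℝ hG0).inv fun x => norm_ne_zero_iff.2 (hG0 x)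
    exact (h1.smul hGc).const_smul (M + 3)
  · intro x
    rw [norm_smul, norm_smul, norm_inv, norm_norm, inv_mul_cancel₀ (norm_ne_zero_iff.2 (hG0 x)),
      mul_one, Real.norm_eq_abs, abs_of_nonneg (by linarith)]
  · intro x hx
    have hχ : χ x = 0 := χ.zero_of_le_dist (by simp [hx, χ])
    have hGx : G x = x := by simp [hG, hχ]
    simp only [hGx, hx]
    rw [smul_smul, mul_inv_cancel₀ (by linarith), one_smul]

/-- **Schauder's fixed point theorem**: a continuous self-map of a nonempty compact convex subset
of a normed space has a fixed point. -/
theorem exists_fixedPoint_of_isCompact_of_convex {X : Type*} [NormedAddCommGroup X]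
    [NormedSpace ℝ X] {K : Set X} (hK : IsCompact K) (hconv : Convex ℝ K) (hne : K.Nonempty)
    {Φ : X → X} (hΦ : ContinuousOn Φ K) (hmaps : MapsTo Φ K K) : ∃ x ∈ K, Φ x = x := by
  have key : ∀ ε > 0, ∃ x ∈ K, ‖Φ x - x‖ ≤ ε := by
    intro ε hε
    obtain ⟨t, htK, htf, hcov⟩ := hK.finite_cover_balls hε
    have htf' := htf.fintype
    let e := Fintype.equivFin t
    set m := Fintype.card t
    let c : Fin m → X := fun i => (e.symm i : X)
    have hcK : ∀ i, c i ∈ K := fun i => htK (e.symm i).2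
    have hccov : ∀ y ∈ K, ∃ i, ‖y - c i‖ < ε := by
      intro y hy
      obtain ⟨z, hz, hyz⟩ := mem_iUnion₂.1 (hcov hy)
      exact ⟨e ⟨z, hz⟩, by simpa [c, dist_eq_norm] using hyz⟩
    have hm : 0 < (m : ℝ) := by
      obtain ⟨y, hy⟩ := hne
      obtain ⟨i, -⟩ := hccov y hy
      exact_mod_cast i.pos
    let w : Fin m → X → ℝ := fun i y => max 0 (ε - ‖y - c i‖)
    have hw0 : ∀ i y, 0 ≤ w i y := fun i y => le_max_left _ _
    have hW : ∀ y ∈ K, 0 < ∑ i, w i y := by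
      intro y hy
      obtain ⟨i, hi⟩ := hccov y hy
      refine Finset.sum_pos' (fun i _ => hw0 i y) ⟨i, Finset.mem_univ _, ?_⟩
      exact lt_max_of_lt_right (by linarith)
    let S : EuclideanSpace ℝ (Fin m) → ℝ := fun v => ∑ i, |v i|
    have hS : Continuous S := by fun_prop
    let q : EuclideanSpace ℝ (Fin m) → Fin m → ℝ := fun v i =>
      (|v i| + max 0 (1 - S v) / m) / max 1 (S v)
    have hqc : ∀ i, Continuous fun v => q v i := fun i => by
      refine Continuous.div (by fun_prop) (by fun_prop) fun v => ?_
      exact (lt_max_of_lt_left one_pos).ne'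
    have hq0 : ∀ v i, 0 ≤ q v i := fun v i => by
      have : (0 : ℝ) ≤ max 0 (1 - S v) := le_max_left _ _
      have : (0 : ℝ) ≤ max 1 (S v) := zero_le_one.trans (le_max_left _ _)
      positivity
    have hq1 : ∀ v, ∑ i, q v i = 1 := by
      intro v
      simp only [q]
      rw [← Finset.sum_div, Finset.sum_add_distrib, Finset.sum_const, Finset.card_univ,
        Fintype.card_fin, nsmul_eq_mul, mul_div_cancel₀ _ hm.ne',
        div_eq_one_iff_eq (lt_max_of_lt_left one_pos).ne']
      change S v + _ = _
      rcases le_total 1 (S v) with h | h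
      · rw [max_eq_left (by linarith), max_eq_right h, add_zero]
      · rw [max_eq_right (by linarith), max_eq_left h]; ring
    let p : EuclideanSpace ℝ (Fin m) → X := fun v => ∑ i, q v i • c i
    have hpc : Continuous p := by
      refine continuous_finsetSum _ fun i _ => (hqc i).smul continuous_const
    have hpK : ∀ v, p v ∈ K := fun v =>
      hconv.sum_mem (fun i _ => hq0 v i) (hq1 v) fun i _ => hcK i
    have hΦp : Continuous fun v => Φ (p v) := hΦ.comp_continuous hpc hpK
    let W : EuclideanSpace ℝ (Fin m) → Fin m → ℝ := fun v i =>
      w i (Φ (p v)) / ∑ j, w j (Φ (p v))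
    have hW0 : ∀ v i, 0 ≤ W v i := fun v i =>
      div_nonneg (hw0 i _) (hW _ (hmaps (hpK v))).le
    have hW1 : ∀ v, ∑ i, W v i = 1 := fun v => by
      simp only [W]
      rw [← Finset.sum_div, div_self (hW _ (hmaps (hpK v))).ne']
    have hwc : ∀ i, Continuous fun v => w i (Φ (p v)) := fun i =>
      continuous_const.max (continuous_const.sub (hΦp.sub continuous_const).norm)
    have hWc : ∀ i, Continuous fun v => W v i := fun i => by
      refine Continuous.div (hwc i) (continuous_finsetSum _ fun j _ => hwc j) fun v =>
          (hW _ (hmaps (hpK v))).ne'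
    have hle : ∀ v i, W v i ≤ 1 := fun v i => by
      rw [← hW1 v]
      exact Finset.single_le_sum (fun j _ => hW0 v j) (Finset.mem_univ i)
    obtain ⟨v, hv⟩ := exists_fixedPoint_of_continuous_of_bounded
      (F := fun v => WithLp.toLp 2 (W v))
      ((PiLp.continuous_toLp 2 _).comp (continuous_pi hWc)) (M := 1) (fun v => by
        rw [EuclideanSpace.norm_eq, Real.sqrt_le_iff, one_pow, ← hW1 v]
        refine ⟨zero_le_one.trans (hW1 v).ge, ?_⟩
        refine Finset.sum_le_sum fun i _ => ?_
        simp only [Real.norm_eq_abs, sq_abs]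
        nlinarith [hW0 v i, hle v i])
    have hvi : ∀ i, W v i = v i := fun i => congrArg (fun z => z.ofLp i) hv
    have hSv : S v = 1 := by
      simp only [S]
      rw [← hW1 v]
      exact Finset.sum_congr rfl fun i _ => by rw [← hvi, abs_of_nonneg (hW0 v i)]
    have hqv : ∀ i, q v i = W v i := fun i => by
      simp only [q]
      rw [hSv, ← hvi, abs_of_nonneg (hW0 v i)]
      simp
    refine ⟨p v, hpK v, ?_⟩
    have h1 : Φ (p v) - p v = ∑ i, W v i • (Φ (p v) - c i) := by
      simp only [smul_sub, Finset.sum_sub_distrib]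
      rw [← Finset.sum_smul, hW1, one_smul]
      congr 1
      exact Finset.sum_congr rfl fun i _ => by rw [hqv]
    rw [h1]
    calc ‖∑ i, W v i • (Φ (p v) - c i)‖ ≤ ∑ i, W v i * ε := by
          refine norm_sum_le_of_le _ fun i _ => ?_
          rw [norm_smul, Real.norm_eq_abs, abs_of_nonneg (hW0 v i)]
          by_cases h : ‖Φ (p v) - c i‖ ≤ ε
          · exact mul_le_mul_of_nonneg_left h (hW0 v i)
          · have : W v i = 0 := by
              simp only [W, w]
              rw [max_eq_left (by linarith), zero_div]
            simp [this]
      _ = ε := by rw [← Finset.sum_mul, hW1, one_mul]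
  obtain ⟨x, hx, hmin⟩ := hK.exists_isMinOn hne
    ((hΦ.sub continuousOn_id).norm : ContinuousOn (fun x => ‖Φ x - x‖) K)
  refine ⟨x, hx, sub_eq_zero.1 (norm_le_zero_iff.1 (le_of_forall_pos_le_add fun ε hε => ?_))⟩
  obtain ⟨y, hy, hyε⟩ := key ε hε
  rw [zero_add]
  exact (hmin hy).trans hyε

/-- Termwise integration of a series of continuous functions dominated by a summable sequence. -/
theorem hasSum_intervalIntegral_of_bound {f : ℕ → ℝ → ℝ} (hf : ∀ k, Continuous (f k)) {b : ℕ → ℝ}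
    (hb : Summable b) (h : ∀ k z, |f k z| ≤ b k) (x y : ℝ) :
    HasSum (fun k => ∫ z in x..y, f k z) (∫ z in x..y, ∑' k, f k z) := by
  refine intervalIntegral.hasSum_integral_of_dominated_convergence (fun k _ => b k)
    (fun k => (hf k).aestronglyMeasurable) (fun k => ?_) ?_ ?_ ?_
  · exact Eventually.of_forall fun z _ => h k z
  · exact Eventually.of_forall fun _ _ => hb
  · exact intervalIntegrable_const
  · exact Eventually.of_forall fun z _ => (Summable.of_norm_bounded hb fun k => h k z).hasSum

section Orthogonal

variable {e : ℕ → ℝ → ℝ} {x y c : ℝ} {a : ℕ → ℝ}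

/-- Coefficients of an absolutely convergent series in a bounded orthogonal system. -/
theorem intervalIntegral_tsum_mul_of_orthogonal (he : ∀ k, Continuous (e k))
    (he1 : ∀ k z, |e k z| ≤ 1)
    (horth : ∀ i j, ∫ z in x..y, e i z * e j z = if i = j then c else 0)
    (ha : Summable fun k => |a k|) (j : ℕ) :
    ∫ z in x..y, (∑' k, a k * e k z) * e j z = c * a j := by
  have h := hasSum_intervalIntegral_of_bound (f := fun k z => a k * e k z * e j z)
    (fun k => (continuous_const.mul (he k)).mul (he j)) ha (fun k z => by
      rw [abs_mul, abs_mul, mul_assoc]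
      exact mul_le_of_le_one_right (abs_nonneg _)
        (mul_le_one₀ (he1 k z) (abs_nonneg _) (he1 j z))) x y
  simp_rw [tsum_mul_right] at h
  rw [← h.tsum_eq, tsum_eq_single j]
  · simp_rw [mul_assoc]
    rw [intervalIntegral.integral_const_mul, horth, if_pos rfl, mul_comm]
  · intro k hk
    simp_rw [mul_assoc]
    rw [intervalIntegral.integral_const_mul, horth, if_neg hk, mul_zero]

/-- Parseval's identity for an absolutely convergent series in a bounded orthogonal system. -/
theorem hasSum_sq_of_orthogonal (he : ∀ k, Continuous (e k))
    (he1 : ∀ k z, |e k z| ≤ 1)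
    (horth : ∀ i j, ∫ z in x..y, e i z * e j z = if i = j then c else 0)
    (ha : Summable fun k => |a k|) :
    HasSum (fun k => c * a k ^ 2) (∫ z in x..y, (∑' k, a k * e k z) ^ 2) := by
  have hb : ∀ k z, |a k * e k z| ≤ |a k| := fun k z => by
    rw [abs_mul]; exact mul_le_of_le_one_right (abs_nonneg _) (he1 k z)
  have hPc : Continuous fun z => ∑' k, a k * e k z :=
    continuous_tsum (fun k => continuous_const.mul (he k)) ha hb
  have hP : ∀ z, |∑' k, a k * e k z| ≤ ∑' k, |a k| := fun z => by
    rw [← Real.norm_eq_abs]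
    exact tsum_of_norm_bounded ha.hasSum fun k => hb k z
  have h := hasSum_intervalIntegral_of_bound
    (f := fun j z => a j * ((∑' k, a k * e k z) * e j z)) (b := fun j => |a j| * ∑' k, |a k|)
    (fun j => continuous_const.mul (hPc.mul (he j))) (ha.mul_right _) (fun j z => by
      rw [abs_mul, abs_mul]
      refine mul_le_mul_of_nonneg_left ?_ (abs_nonneg _)
      exact (mul_le_of_le_one_right (abs_nonneg _) (he1 j z)).trans (hP z)) x y
  convert h using 1
  · funext j
    rw [intervalIntegral.integral_const_mul,
      intervalIntegral_tsum_mul_of_orthogonal he he1 horth ha]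
    ring
  · congr 1
    funext z
    have h2 : ∀ j, a j * ((∑' k, a k * e k z) * e j z) = (∑' k, a k * e k z) * (a j * e j z) :=
      fun j => by ring
    simp_rw [h2]
    rw [tsum_mul_left, sq]

end Orthogonal

theorem integral_cos_int_mul_pi (m : ℤ) :
    ∫ z in (0 : ℝ)..1, cos (m * π * z) = if m = 0 then 1 else 0 := by
  split_ifs with h
  · simp [h]
  · have hm : (m : ℝ) * π ≠ 0 := mul_ne_zero (by exact_mod_cast h) pi_ne_zero
    rw [intervalIntegral.integral_comp_mul_left (fun w => cos w) hm, integral_cos]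
    simp [Real.sin_int_mul_pi]

theorem integral_symm_cos_int_mul_pi (m : ℤ) :
    ∫ z in (-1 : ℝ)..1, cos (m * π * z) = if m = 0 then 2 else 0 := by
  split_ifs with h
  · simp [h]; norm_num
  · have hm : (m : ℝ) * π ≠ 0 := mul_ne_zero (by exact_mod_cast h) pi_ne_zero
    rw [intervalIntegral.integral_comp_mul_left (fun w => cos w) hm, integral_cos]
    simp [Real.sin_int_mul_pi]

theorem integral_sin_mul_sin (i j : ℕ) :
    ∫ z in (0 : ℝ)..1, sin ((i + 1) * π * z) * sin ((j + 1) * π * z) =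
      if i = j then 1 / 2 else 0 := by
  have h : ∀ z : ℝ, sin ((i + 1) * π * z) * sin ((j + 1) * π * z) =
      (cos (((i - j : ℤ) : ℝ) * π * z) - cos (((i + j + 2 : ℤ) : ℝ) * π * z)) * (1 / 2) :=
          fun z => by
    have h1 : ((i - j : ℤ) : ℝ) * π * z = (i + 1) * π * z - (j + 1) * π * z := by push_cast; ring
    have h2 : ((i + j + 2 : ℤ) : ℝ) * π * z = (i + 1) * π * z + (j + 1) * π * z := by
      push_cast; ring
    rw [h1, h2, cos_sub, cos_add]; ring
  simp_rw [h]
  rw [intervalIntegral.integral_mul_const, intervalIntegral.integral_sub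
    (Continuous.intervalIntegrable (by fun_prop) _ _)
    (Continuous.intervalIntegrable (by fun_prop) _ _), integral_cos_int_mul_pi,
    integral_cos_int_mul_pi, if_neg (by omega : (i : ℤ) + j + 2 ≠ 0)]
  by_cases hij : i = j
  · simp [hij]
  · rw [if_neg (by omega), if_neg hij]; ring

theorem integral_symm_cos_mul_cos (i j : ℕ) :
    ∫ z in (-1 : ℝ)..1, cos ((i + 1) * π * z) * cos ((j + 1) * π * z) =
      if i = j then 1 else 0 := by
  have h : ∀ z : ℝ, cos ((i + 1) * π * z) * cos ((j + 1) * π * z) =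
      (cos (((i - j : ℤ) : ℝ) * π * z) + cos (((i + j + 2 : ℤ) : ℝ) * π * z)) * (1 / 2) :=
          fun z => by
    have h1 : ((i - j : ℤ) : ℝ) * π * z = (i + 1) * π * z - (j + 1) * π * z := by push_cast; ring
    have h2 : ((i + j + 2 : ℤ) : ℝ) * π * z = (i + 1) * π * z + (j + 1) * π * z := by
      push_cast; ring
    rw [h1, h2, cos_sub, cos_add]; ring
  simp_rw [h]
  rw [intervalIntegral.integral_mul_const, intervalIntegral.integral_add
    (Continuous.intervalIntegrable (by fun_prop) _ _)
    (Continuous.intervalIntegrable (by fun_prop) _ _), integral_symm_cos_int_mul_pi,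
    integral_symm_cos_int_mul_pi, if_neg (by omega : (i : ℤ) + j + 2 ≠ 0)]
  by_cases hij : i = j
  · simp [hij]
  · rw [if_neg (by omega), if_neg hij]; ring

theorem integral_symm_sin_mul_sin_half (i j : ℕ) :
    ∫ z in (-1 : ℝ)..1, sin ((i + 1 / 2) * π * z) * sin ((j + 1 / 2) * π * z) =
      if i = j then 1 else 0 := by
  have h : ∀ z : ℝ, sin ((i + 1 / 2) * π * z) * sin ((j + 1 / 2) * π * z) =
      (cos (((i - j : ℤ) : ℝ) * π * z) - cos (((i + j + 1 : ℤ) : ℝ) * π * z)) * (1 / 2) :=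
          fun z => by
    have h1 : ((i - j : ℤ) : ℝ) * π * z = (i + 1 / 2) * π * z - (j + 1 / 2) * π * z := by
      push_cast; ring
    have h2 : ((i + j + 1 : ℤ) : ℝ) * π * z = (i + 1 / 2) * π * z + (j + 1 / 2) * π * z := by
      push_cast; ring
    rw [h1, h2, cos_sub, cos_add]; ring
  simp_rw [h]
  rw [intervalIntegral.integral_mul_const, intervalIntegral.integral_sub
    (Continuous.intervalIntegrable (by fun_prop) _ _)
    (Continuous.intervalIntegrable (by fun_prop) _ _), integral_symm_cos_int_mul_pi,
    integral_symm_cos_int_mul_pi, if_neg (by omega : (i : ℤ) + j + 1 ≠ 0)]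
  by_cases hij : i = j
  · simp [hij]
  · rw [if_neg (by omega), if_neg hij]; ring

/-- `y ^ p * exp (-c y⁴)` decays at least quadratically. -/
theorem exists_pow_mul_exp_neg_le (p : ℕ) {c : ℝ} (hc : 0 < c) :
    ∃ C > 0, ∀ y : ℝ, 0 ≤ y → y ^ p * exp (-(c * y ^ 4)) ≤ C / (1 + y) ^ 2 := by
  refine ⟨(p + 2).factorial / c ^ (p + 2) * exp (2 * c), by positivity, fun y hy => ?_⟩
  have h1 := Real.pow_div_factorial_le_exp (c * (1 + y)) (by positivity) (p + 2)
  have h2 : exp (-(c * y ^ 4)) ≤ exp (2 * c) / exp (c * (1 + y)) := by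
    rw [← exp_sub]
    refine exp_le_exp.2 ?_
    have : y ≤ y ^ 4 + 1 := by nlinarith [sq_nonneg (y ^ 2 - 1 / 2), sq_nonneg (y - 1 / 2)]
    nlinarith
  have h3 : y ^ p * (1 + y) ^ 2 ≤ (1 + y) ^ (p + 2) := by
    rw [pow_add]
    gcongr
    linarith
  have h4 : (1 + y) ^ (p + 2) ≤ (p + 2).factorial / c ^ (p + 2) * exp (c * (1 + y)) := by
    rw [mul_pow, div_le_iff₀ (by positivity)] at h1
    rw [div_mul_eq_mul_div, le_div_iff₀ (by positivity)]
    linarith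
  rw [le_div_iff₀ (by positivity)]
  calc y ^ p * exp (-(c * y ^ 4)) * (1 + y) ^ 2
      = y ^ p * (1 + y) ^ 2 * exp (-(c * y ^ 4)) := by ring
    _ ≤ ((p + 2).factorial / c ^ (p + 2) * exp (c * (1 + y))) *
        (exp (2 * c) / exp (c * (1 + y))) := by
        exact mul_le_mul (h3.trans h4) h2 (exp_pos _).le (by positivity)
    _ = _ := by
        have := (exp_pos (c * (1 + y))).ne'
        field_simp

theorem sum_range_one_div_sq_le {δ : ℝ} (hδ : 0 < δ) (n : ℕ) :
    ∑ k ∈ Finset.range n, 1 / (1 + (k + 1) * δ) ^ 2 ≤ 1 / δ := by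
  have h : ∑ k ∈ Finset.range n, 1 / (1 + (k + 1) * δ) ^ 2 ≤ 1 / δ * (1 - 1 / (1 + n * δ)) := by
    induction n with
    | zero => simp
    | succ n ih =>
      rw [Finset.sum_range_succ]
      have : 1 / (1 + ((n : ℝ) + 1) * δ) ^ 2 ≤
          1 / δ * (1 / (1 + n * δ) - 1 / (1 + ((n : ℝ) + 1) * δ)) := by
        have h1 : 1 / δ * (1 / (1 + n * δ) - 1 / (1 + ((n : ℝ) + 1) * δ)) =
            1 / ((1 + n * δ) * (1 + ((n : ℝ) + 1) * δ)) := by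
          field_simp
          ring
        rw [h1]
        refine one_div_le_one_div_of_le (by positivity) ?_
        rw [sq]
        gcongr
        linarith
      push_cast
      linarith
  refine h.trans ?_
  have : 0 ≤ 1 / (1 + n * δ) := by positivity
  have : 0 < 1 / δ := by positivity
  nlinarith

/-- Scaling bound for the moments of the quartic Gaussian sequence. -/
theorem exists_tsum_pow_mul_exp_neg_le (p : ℕ) {c : ℝ} (hc : 0 < c) :
    ∃ C > 0, ∀ δ : ℝ, 0 < δ →
      (Summable fun k : ℕ => ((k : ℝ) + 1) ^ p * exp (-(c * ((k + 1) * δ) ^ 4))) ∧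
      ∑' k : ℕ, ((k : ℝ) + 1) ^ p * exp (-(c * ((k + 1) * δ) ^ 4)) ≤ C / δ ^ (p + 1) := by
  obtain ⟨C, hC, h⟩ := exists_pow_mul_exp_neg_le p hc
  refine ⟨C, hC, fun δ hδ => ?_⟩
  have hle : ∀ k : ℕ, ((k : ℝ) + 1) ^ p * exp (-(c * ((k + 1) * δ) ^ 4)) ≤
      C / δ ^ p * (1 / (1 + (k + 1) * δ) ^ 2) := fun k => by
    have := h ((k + 1) * δ) (by positivity)
    rw [mul_pow] at this
    rw [div_mul_div_comm, mul_one, mul_comm (δ ^ p), ← div_div, le_div_iff₀ (by positivity)]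
    linarith
  have hs : ∀ n, ∑ k ∈ Finset.range n, ((k : ℝ) + 1) ^ p * exp (-(c * ((k + 1) * δ) ^ 4)) ≤
      C / δ ^ (p + 1) := fun n => by
    refine (Finset.sum_le_sum fun k _ => hle k).trans ?_
    rw [← Finset.mul_sum, pow_succ, ← div_div, div_eq_mul_one_div (C / δ ^ p) δ]
    exact mul_le_mul_of_nonneg_left (sum_range_one_div_sq_le hδ n) (by positivity)
  exact ⟨summable_of_sum_range_le (fun k => by positivity) hs,
    Real.tsum_le_of_sum_range_le (fun k => by positivity) hs⟩

/-- Dirichlet eigenvalues of `γ ∂ₓ⁴ - ∂ₓ² - 1` on `(0,1)` (with `∂ₓ² u = 0` at the boundary). -/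
noncomputable def efkEig (γ : ℝ) (k : ℕ) : ℝ := γ * ((k + 1) * π) ^ 4 + ((k + 1) * π) ^ 2 - 1

theorem le_efkEig (γ : ℝ) (k : ℕ) : γ * π ^ 4 * (k + 1) ^ 4 ≤ efkEig γ k := by
  have h : 1 ≤ ((k + 1 : ℝ) * π) ^ 2 := by
    refine one_le_pow₀ ?_
    have := pi_gt_three
    nlinarith [(Nat.cast_nonneg k : (0 : ℝ) ≤ k)]
  unfold efkEig
  rw [mul_pow] at h ⊢
  linarith

theorem efkEig_le {γ : ℝ} (k : ℕ) :
    efkEig γ k ≤ (γ * π ^ 4 + π ^ 2) * (k + 1) ^ 4 := by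
  have h : ((k : ℝ) + 1) ^ 2 ≤ (k + 1) ^ 4 :=
    pow_le_pow_right₀ (by linarith [(Nat.cast_nonneg k : (0 : ℝ) ≤ k)]) (by norm_num)
  have : 0 ≤ π ^ 2 := by positivity
  unfold efkEig
  nlinarith

theorem efkEig_pos {γ : ℝ} (hγ : 0 < γ) (k : ℕ) : 0 < efkEig γ k :=
  lt_of_lt_of_le (by positivity) (le_efkEig γ k)

theorem efkEig_mono {γ : ℝ} (hγ : 0 < γ) : Monotone (efkEig γ) := by
  intro i j hij
  have : (i : ℝ) ≤ j := by exact_mod_cast hij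
  unfold efkEig
  gcongr

theorem efkEig_succ_sub_le {γ : ℝ} (hγ : 0 < γ) (k : ℕ) :
    efkEig γ (k + 1) - efkEig γ k ≤ (15 * (γ * π ^ 4) + 3 * π ^ 2) * (k + 1) ^ 3 := by
  have h : (1 : ℝ) ≤ k + 1 := by linarith [(Nat.cast_nonneg k : (0 : ℝ) ≤ k)]
  have h1 : (0 : ℝ) ≤ γ * π ^ 4 := by positivity
  have h2 : (0 : ℝ) ≤ π ^ 2 := by positivity
  unfold efkEig
  push_cast
  generalize (k : ℝ) + 1 = m at *
  have h3 : (m + 1) ^ 4 - m ^ 4 ≤ 15 * m ^ 3 := by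
    nlinarith [mul_nonneg (sub_nonneg.2 h) (sq_nonneg m),
      mul_nonneg (sub_nonneg.2 h) (sub_nonneg.2 h),
      mul_nonneg (sub_nonneg.2 h) (mul_nonneg (sub_nonneg.2 h) (sub_nonneg.2 h))]
  have h4 : (m + 1) ^ 2 - m ^ 2 ≤ 3 * m ^ 3 := by
    nlinarith [mul_nonneg (sub_nonneg.2 h) (sq_nonneg m),
      mul_nonneg (sub_nonneg.2 h) (sub_nonneg.2 h),
      mul_nonneg (sub_nonneg.2 h) (mul_nonneg (sub_nonneg.2 h) (sub_nonneg.2 h))]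
  have := mul_le_mul_of_nonneg_left h3 h1
  have := mul_le_mul_of_nonneg_left h4 h2
  linarith

theorem abs_sq_mul_exp_sub_le {x y s : ℝ} (hx : 0 < x) (hxy : x ≤ y) (hs : 0 < s) :
    |x ^ 2 * exp (-(x * s)) - y ^ 2 * exp (-(y * s))| ≤ 3 * y * (y - x) * exp (-(x * s / 2)) := by
  have e1 : exp (-(x * s)) ≤ exp (-(x * s / 2)) := exp_le_exp.2 (by nlinarith [mul_pos hx hs])
  have e2 : exp (-(y * s)) ≤ exp (-(x * s)) := exp_le_exp.2 (by nlinarith)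
  have hd : 0 ≤ y - x := sub_nonneg.2 hxy
  have p1 := exp_pos (-(x * s / 2))
  rw [abs_le]
  constructor
  · have h1 : y ^ 2 * exp (-(y * s)) ≤ y ^ 2 * exp (-(x * s)) := by gcongr
    have h2 : (y ^ 2 - x ^ 2) * exp (-(x * s)) ≤ (y ^ 2 - x ^ 2) * exp (-(x * s / 2)) :=
      mul_le_mul_of_nonneg_left e1 (by nlinarith)
    have h3 : (y ^ 2 - x ^ 2) * exp (-(x * s / 2)) ≤ 3 * y * (y - x) * exp (-(x * s / 2)) :=
      mul_le_mul_of_nonneg_right (by nlinarith) p1.le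
    linarith
  · have h1 : x ^ 2 * exp (-(y * s)) ≤ y ^ 2 * exp (-(y * s)) := by gcongr
    have h2 : exp (-(x * s)) - exp (-(y * s)) ≤ exp (-(x * s)) * ((y - x) * s) := by
      have : exp (-(y * s)) = exp (-(x * s)) * exp (-((y - x) * s)) := by
        rw [← exp_add]; congr 1; ring
      have := add_one_le_exp (-((y - x) * s))
      have := exp_pos (-(x * s))
      nlinarith
    have h3 : x * s * exp (-(x * s / 2)) ≤ 2 := by
      have := add_one_le_exp (x * s / 2)
      rw [exp_neg, ← div_eq_mul_inv, div_le_iff₀ (exp_pos _)]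
      linarith
    have h4 : exp (-(x * s)) = exp (-(x * s / 2)) * exp (-(x * s / 2)) := by
      rw [← exp_add]; congr 1; ring
    calc x ^ 2 * exp (-(x * s)) - y ^ 2 * exp (-(y * s))
        ≤ x ^ 2 * (exp (-(x * s)) - exp (-(y * s))) := by linarith
      _ ≤ x ^ 2 * (exp (-(x * s)) * ((y - x) * s)) := by gcongr
      _ = x * (y - x) * exp (-(x * s / 2)) * (x * s * exp (-(x * s / 2))) := by rw [h4]; ring
      _ ≤ x * (y - x) * exp (-(x * s / 2)) * 2 := by gcongr
      _ ≤ 3 * y * (y - x) * exp (-(x * s / 2)) := by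
        have : x * 2 ≤ 3 * y := by linarith
        have : 0 ≤ (y - x) * exp (-(x * s / 2)) := by positivity
        nlinarith

/-- Backward differences of `a`, with `a (-1) = 0` and a reversed sign. -/
def backDiff (a : ℕ → ℝ) : ℕ → ℝ
  | 0 => -a 0
  | k + 1 => a k - a (k + 1)

theorem summable_abs_backDiff {a : ℕ → ℝ} (ha : Summable fun k => |a k|) :
    Summable fun k => |backDiff a k| := by
  rw [← summable_nat_add_iff 1]
  refine Summable.of_nonneg_of_le (fun _ => abs_nonneg _) (fun k => ?_)
    (ha.add ((summable_nat_add_iff 1).2 ha))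
  exact abs_sub _ _

/-- Summation by parts against `2 sin (π z / 2)`. -/
theorem two_mul_sin_mul_tsum_cos {a : ℕ → ℝ} (ha : Summable fun k => |a k|) (z : ℝ) :
    2 * sin (π * z / 2) * ∑' k : ℕ, a k * cos ((k + 1) * π * z) =
      ∑' k : ℕ, backDiff a k * sin ((k + 1 / 2) * π * z) := by
  have hS : Summable fun k : ℕ => a k * sin ((k + 1 / 2) * π * z) :=
    Summable.of_norm_bounded ha fun k => by
      rw [norm_mul]
      exact mul_le_of_le_one_right (norm_nonneg _) (abs_sin_le_one _)
  have hS' : Summable fun k : ℕ => a k * sin ((k + 1 + 1 / 2) * π * z) :=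
    Summable.of_norm_bounded ha fun k => by
      rw [norm_mul]
      exact mul_le_of_le_one_right (norm_nonneg _) (abs_sin_le_one _)
  have hd : Summable fun k : ℕ => backDiff a k * sin ((k + 1 / 2) * π * z) :=
    Summable.of_norm_bounded (summable_abs_backDiff ha) fun k => by
      rw [norm_mul]
      exact mul_le_of_le_one_right (norm_nonneg _) (abs_sin_le_one _)
  have hS1 := (summable_nat_add_iff 1).2 hS
  rw [hd.tsum_eq_zero_add, ← tsum_mul_left]
  have h1 : ∀ k : ℕ, 2 * sin (π * z / 2) * (a k * cos ((k + 1) * π * z)) =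
      a k * sin ((k + 1 + 1 / 2) * π * z) - a k * sin ((k + 1 / 2) * π * z) := fun k => by
    have e1 : ((k : ℝ) + 1 + 1 / 2) * π * z = (k + 1) * π * z + π * z / 2 := by ring
    have e2 : ((k : ℝ) + 1 / 2) * π * z = (k + 1) * π * z - π * z / 2 := by ring
    rw [e1, e2, sin_add, sin_sub]
    ring
  simp_rw [h1]
  rw [hS'.tsum_sub hS, hS.tsum_eq_zero_add]
  have h2 : ∀ k : ℕ, backDiff a (k + 1) * sin (((k + 1 : ℕ) + 1 / 2) * π * z) =
      a k * sin ((k + 1 + 1 / 2) * π * z) - a (k + 1) * sin (((k + 1 : ℕ) + 1 / 2) * π * z) :=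
    fun k => by simp only [backDiff]; push_cast; ring
  simp_rw [h2]
  rw [hS'.tsum_sub hS1]
  simp only [backDiff, Nat.cast_zero]
  ring

theorem integral_one_div_one_add_div_sq_le {δ : ℝ} (hδ : 0 < δ) :
    ∫ z in (-1 : ℝ)..1, 1 / (1 + (z / δ) ^ 2) ≤ π * δ := by
  rw [intervalIntegral.integral_comp_div (fun w => 1 / (1 + w ^ 2)) hδ.ne']
  rw [integral_one_div_one_add_sq, smul_eq_mul, mul_comm]
  have := arctan_lt_pi_div_two (1 / δ)
  have := neg_pi_div_two_lt_arctan (-1 / δ)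
  gcongr
  linarith

/-- Carlson's inequality for cosine series, at scale `δ`. -/
theorem integral_abs_tsum_cos_le {a : ℕ → ℝ} (ha : Summable fun k => |a k|) {δ α A B : ℝ}
    (hδ : 0 < δ) (hα : 0 < α) (hA : ∑' k, a k ^ 2 ≤ A) (hB : ∑' k, backDiff a k ^ 2 ≤ B) :
    ∫ z in (-1 : ℝ)..1, |∑' k : ℕ, a k * cos ((k + 1) * π * z)| ≤
      (α * (A + B / δ ^ 2) + π * δ / α) / 2 := by
  set P : ℝ → ℝ := fun z => ∑' k : ℕ, a k * cos ((k + 1) * π * z) with hPdef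
  have hPc : Continuous P := continuous_tsum (fun k => by fun_prop) ha fun k z => by
    rw [norm_mul]
    exact mul_le_of_le_one_right (norm_nonneg _) (abs_cos_le_one _)
  have h1 : ∫ z in (-1 : ℝ)..1, P z ^ 2 ≤ A := by
    have := hasSum_sq_of_orthogonal (e := fun (k : ℕ) z => cos ((k + 1) * π * z)) (a := a)
      (fun k => by fun_prop) (fun k z => abs_cos_le_one _) integral_symm_cos_mul_cos ha
    rw [← this.tsum_eq]
    simpa using hA
  have h2 : ∫ z in (-1 : ℝ)..1, (2 * sin (π * z / 2) * P z) ^ 2 ≤ B := by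
    have := hasSum_sq_of_orthogonal (e := fun (k : ℕ) z => sin ((k + 1 / 2) * π * z))
      (fun k => by fun_prop) (fun k z => abs_sin_le_one _) integral_symm_sin_mul_sin_half
      (summable_abs_backDiff ha)
    simp_rw [hPdef, two_mul_sin_mul_tsum_cos ha]
    rw [← this.tsum_eq]
    simpa using hB
  have h3 := integral_one_div_one_add_div_sq_le hδ
  have hpt : ∀ z ∈ Icc (-1 : ℝ) 1, |P z| ≤ α / 2 * (P z ^ 2) +
      α / 2 / δ ^ 2 * (2 * sin (π * z / 2) * P z) ^ 2 + 1 / (2 * α) * (1 / (1 + (z / δ) ^ 2)) := by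
    intro z hz
    have hs : z ^ 2 ≤ sin (π * z / 2) ^ 2 := by
      have key : ∀ w, 0 ≤ w → w ≤ 1 → w ^ 2 ≤ sin (π * w / 2) ^ 2 := fun w h0 h1 => by
        have := Real.mul_le_sin (x := π * w / 2) (by positivity) (by nlinarith [pi_pos])
        have h4 : 2 / π * (π * w / 2) = w := by field_simp
        rw [h4] at this
        gcongr
      rcases le_total 0 z with h | h
      · exact key z h hz.2
      · have := key (-z) (by linarith) (by linarith [hz.1])
        rw [mul_neg, neg_div, sin_neg, neg_sq, neg_sq] at this
        exact this
    set w := 1 + (z / δ) ^ 2 with hw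
    have hwpos : 0 < w := by positivity
    have hP2 : α / 2 * (P z ^ 2) + α / 2 / δ ^ 2 * (2 * sin (π * z / 2) * P z) ^ 2 ≥
        α / 2 * w * P z ^ 2 := by
      have : α / 2 / δ ^ 2 * P z ^ 2 * z ^ 2 ≤
          α / 2 / δ ^ 2 * P z ^ 2 * (4 * sin (π * z / 2) ^ 2) := by
        gcongr
        nlinarith [sq_nonneg (sin (π * z / 2))]
      have e : α / 2 * w * P z ^ 2 = α / 2 * P z ^ 2 + α / 2 / δ ^ 2 * P z ^ 2 * z ^ 2 := by
        rw [hw]; field_simp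
      rw [e]
      linarith
    have hamgm : |P z| ≤ α / 2 * w * P z ^ 2 + 1 / (2 * α) * (1 / w) := by
      have e : α / 2 * w * P z ^ 2 + 1 / (2 * α) * (1 / w) - |P z| =
          (α * w * |P z| - 1) ^ 2 / (2 * α * w) := by
        rw [← sq_abs (P z)]; field_simp; ring
      have : 0 ≤ (α * w * |P z| - 1) ^ 2 / (2 * α * w) := by positivity
      linarith
    linarith
  have hc3 : Continuous fun z : ℝ => 1 / (1 + (z / δ) ^ 2) :=
    continuous_const.div (by fun_prop) fun z => by positivity
  have hc1 : Continuous fun z => α / 2 * (P z ^ 2) := by fun_prop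
  have hc2 : Continuous fun z => α / 2 / δ ^ 2 * (2 * sin (π * z / 2) * P z) ^ 2 := by fun_prop
  have hc4 : Continuous fun z => 1 / (2 * α) * (1 / (1 + (z / δ) ^ 2)) := hc3.const_mul _
  have hc12 : Continuous fun z => α / 2 * (P z ^ 2) +
      α / 2 / δ ^ 2 * (2 * sin (π * z / 2) * P z) ^ 2 := hc1.add hc2
  refine (intervalIntegral.integral_mono_on (by norm_num) (hPc.abs.intervalIntegrable _ _)
    ((hc12.add hc4).intervalIntegrable _ _) hpt).trans ?_
  simp only [Pi.add_apply]
  rw [intervalIntegral.integral_add (hc12.intervalIntegrable _ _)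
    (hc4.intervalIntegrable _ _), intervalIntegral.integral_add (hc1.intervalIntegrable _ _)
    (hc2.intervalIntegrable _ _)]
  simp only [intervalIntegral.integral_const_mul]
  have i1 := mul_le_mul_of_nonneg_left h1 (by positivity : 0 ≤ α / 2)
  have i2 := mul_le_mul_of_nonneg_left h2 (by positivity : 0 ≤ α / 2 / δ ^ 2)
  have i3 := mul_le_mul_of_nonneg_left h3 (by positivity : 0 ≤ 1 / (2 * α))
  have e : (α * (A + B / δ ^ 2) + π * δ / α) / 2 =
      α / 2 * A + α / 2 / δ ^ 2 * B + 1 / (2 * α) * (π * δ) := by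
    field_simp
  rw [e]
  linarith

theorem summable_efkEig_pow_mul_exp {γ : ℝ} (hγ : 0 < γ) (p : ℕ) {s : ℝ} (hs : 0 < s) :
    Summable fun k => efkEig γ k ^ p * exp (-(efkEig γ k * s)) := by
  obtain ⟨C, -, h⟩ := exists_tsum_pow_mul_exp_neg_le (4 * p) (c := γ * π ^ 4 * s) (by positivity)
  refine Summable.of_nonneg_of_le (fun k => ?_) (fun k => ?_)
    ((h 1 one_pos).1.mul_left ((γ * π ^ 4 + π ^ 2) ^ p))
  · have := efkEig_pos hγ k
    positivity
  · rw [← mul_assoc, pow_mul, ← mul_pow]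
    have h1 := (efkEig_pos hγ k).le
    have h2 := le_efkEig γ k
    have h3 := efkEig_le (γ := γ) k
    refine mul_le_mul (pow_le_pow_left₀ h1 h3 p) (exp_le_exp.2 ?_) (exp_pos _).le (by positivity)
    rw [mul_one]
    nlinarith

/-- `L²` bounds for the coefficients of the second time derivative of the heat-type kernel,
and for their differences. -/
theorem exists_tsum_efkEig_sq_mul_exp_le {γ : ℝ} (hγ : 0 < γ) :
    ∃ A > 0, ∃ B > 0, ∀ δ : ℝ, 0 < δ →
      ∑' k, (efkEig γ k ^ 2 * exp (-(efkEig γ k * δ ^ 4))) ^ 2 ≤ A / δ ^ 17 ∧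
      ∑' k, backDiff (fun k => efkEig γ k ^ 2 * exp (-(efkEig γ k * δ ^ 4))) k ^ 2 ≤
          B / δ ^ 15 := by
  have hc : 0 < γ * π ^ 4 := by positivity
  obtain ⟨A, hA, hA'⟩ := exists_tsum_pow_mul_exp_neg_le 16 (c := γ * π ^ 4) hc
  obtain ⟨B, hB, hB'⟩ := exists_tsum_pow_mul_exp_neg_le 14 (c := γ * π ^ 4) hc
  set C₁ := γ * π ^ 4 + π ^ 2 with hC₁
  set C₂ := 15 * (γ * π ^ 4) + 3 * π ^ 2 with hC₂
  have hC₁pos : 0 < C₁ := by positivity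
  have hC₂pos : 0 < C₂ := by positivity
  refine ⟨C₁ ^ 4 * A, by positivity, (C₁ ^ 4 + (48 * C₁ * C₂) ^ 2) * B, by positivity,
    fun δ hδ => ?_⟩
  obtain ⟨sA, tA⟩ := hA' δ hδ
  obtain ⟨sB, tB⟩ := hB' δ hδ
  have hexp : ∀ k, exp (-(efkEig γ k * δ ^ 4)) ≤ exp (-(γ * π ^ 4 * ((k + 1) * δ) ^ 4)) :=
      fun k => by
    refine exp_le_exp.2 ?_
    have := mul_le_mul_of_nonneg_right (le_efkEig γ k) (by positivity : 0 ≤ δ ^ 4)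
    rw [mul_pow]
    linarith
  have hexp1 : ∀ k, exp (-(efkEig γ k * δ ^ 4)) ≤ 1 := fun k =>
    exp_le_one_iff.2 (by have := efkEig_pos hγ k; have : 0 < efkEig γ k * δ ^ 4 := by positivity
                         linarith)
  have hsq : ∀ k, (efkEig γ k ^ 2 * exp (-(efkEig γ k * δ ^ 4))) ^ 2 ≤
      C₁ ^ 4 * ((k + 1 : ℝ) ^ 16 * exp (-(γ * π ^ 4 * ((k + 1) * δ) ^ 4))) := fun k => by
    have h1 := (efkEig_pos hγ k).le
    have h2 := pow_le_pow_left₀ h1 (efkEig_le (γ := γ) k) 4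
    have h3 := hexp k
    have h4 := hexp1 k
    have h5 := exp_pos (-(efkEig γ k * δ ^ 4))
    calc (efkEig γ k ^ 2 * exp (-(efkEig γ k * δ ^ 4))) ^ 2
        = efkEig γ k ^ 4 * (exp (-(efkEig γ k * δ ^ 4)) * exp (-(efkEig γ k * δ ^ 4))) := by ring
      _ ≤ (C₁ * (k + 1) ^ 4) ^ 4 * (exp (-(γ * π ^ 4 * ((k + 1) * δ) ^ 4)) * 1) := by gcongr
      _ = _ := by ring
  constructor
  · have := (Summable.of_nonneg_of_le (fun k => sq_nonneg _) hsq (sA.mul_left _)).tsum_le_tsum hsq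
      (sA.mul_left _)
    refine this.trans ?_
    rw [tsum_mul_left, mul_div_assoc]
    gcongr
  · set a : ℕ → ℝ := fun k => efkEig γ k ^ 2 * exp (-(efkEig γ k * δ ^ 4)) with ha
    set b : ℕ → ℝ := fun k => (k + 1 : ℝ) ^ 14 * exp (-(γ * π ^ 4 * ((k + 1) * δ) ^ 4)) with hb
    have hdiff : ∀ k, backDiff a (k + 1) ^ 2 ≤ (48 * C₁ * C₂) ^ 2 * b k := fun k => by
      have h0 := efkEig_pos hγ k
      have hm := efkEig_mono hγ (Nat.le_succ k)
      have h1 := abs_sq_mul_exp_sub_le h0 hm (pow_pos hδ 4)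
      have h2 := efkEig_succ_sub_le hγ k
      have h3 : efkEig γ (k + 1) ≤ C₁ * (16 * (k + 1) ^ 4) := by
        refine (efkEig_le (γ := γ) (k + 1)).trans ?_
        have : ((k + 1 : ℕ) + 1 : ℝ) ≤ 2 * (k + 1) := by
          push_cast
          linarith [(Nat.cast_nonneg k : (0 : ℝ) ≤ k)]
        have := pow_le_pow_left₀ (by positivity) this 4
        rw [mul_pow] at this
        norm_num at this ⊢
        exact mul_le_mul_of_nonneg_left this hC₁pos.le
      have h4 : |backDiff a (k + 1)| ≤ 48 * C₁ * C₂ *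
          ((k + 1) ^ 7 * exp (-(efkEig γ k * δ ^ 4 / 2))) := by
        refine h1.trans ?_
        have : efkEig γ (k + 1) * (efkEig γ (k + 1) - efkEig γ k) ≤
            C₁ * (16 * (k + 1) ^ 4) * (C₂ * (k + 1) ^ 3) :=
          mul_le_mul h3 h2 (sub_nonneg.2 hm) (by positivity)
        have := mul_le_mul_of_nonneg_right this (exp_pos (-(efkEig γ k * δ ^ 4 / 2))).le
        have e : 48 * C₁ * C₂ * ((k + 1) ^ 7 * exp (-(efkEig γ k * δ ^ 4 / 2))) =
          3 * (C₁ * (16 * (k + 1) ^ 4) * (C₂ * (k + 1) ^ 3) *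
            exp (-(efkEig γ k * δ ^ 4 / 2))) := by ring
        rw [e]
        simp only [Nat.succ_eq_add_one] at *
        linarith
      calc backDiff a (k + 1) ^ 2 = |backDiff a (k + 1)| ^ 2 := (sq_abs _).symm
        _ ≤ (48 * C₁ * C₂ * ((k + 1) ^ 7 * exp (-(efkEig γ k * δ ^ 4 / 2)))) ^ 2 := by gcongr
        _ = (48 * C₁ * C₂) ^ 2 * ((k + 1) ^ 14 * (exp (-(efkEig γ k * δ ^ 4 / 2)) *
            exp (-(efkEig γ k * δ ^ 4 / 2)))) := by ring
        _ = (48 * C₁ * C₂) ^ 2 * ((k + 1) ^ 14 * exp (-(efkEig γ k * δ ^ 4))) := by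
            rw [← exp_add]; congr 4; ring
        _ ≤ _ := by
            have := hexp k
            simp only [hb]
            gcongr
    have hs1 : Summable fun k => backDiff a (k + 1) ^ 2 :=
      Summable.of_nonneg_of_le (fun k => sq_nonneg _) hdiff (sB.mul_left _)
    have hs : Summable fun k => backDiff a k ^ 2 :=
      (summable_nat_add_iff (f := fun k => backDiff a k ^ 2) 1).1 hs1
    have h0 : backDiff a 0 ^ 2 ≤ C₁ ^ 4 * b 0 := by
      have := hsq 0
      simpa [backDiff, ha, hb] using this
    have hb0 : b 0 ≤ B / δ ^ 15 := (sB.le_tsum 0 fun k _ => by positivity).trans tB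
    rw [hs.tsum_eq_zero_add]
    have h5 := hs1.tsum_le_tsum hdiff (sB.mul_left _)
    rw [tsum_mul_left] at h5
    have h6 := mul_le_mul_of_nonneg_left tB (by positivity : 0 ≤ (48 * C₁ * C₂) ^ 2)
    have h7 := mul_le_mul_of_nonneg_left hb0 (by positivity : 0 ≤ C₁ ^ 4)
    have e : (C₁ ^ 4 + (48 * C₁ * C₂) ^ 2) * B / δ ^ 15 =
      C₁ ^ 4 * (B / δ ^ 15) + (48 * C₁ * C₂) ^ 2 * (B / δ ^ 15) := by ring
    rw [e]
    linarith

/-- `L¹` bound of the second time derivative of the heat-type kernel. -/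
theorem exists_integral_abs_kernel_le {γ : ℝ} (hγ : 0 < γ) :
    ∃ C > 0, ∀ s : ℝ, 0 < s →
      ∫ z in (-1 : ℝ)..1, |∑' k : ℕ, efkEig γ k ^ 2 * exp (-(efkEig γ k * s)) *
        cos ((k + 1) * π * z)| ≤ C / s ^ 2 := by
  obtain ⟨A, hA, B, hB, h⟩ := exists_tsum_efkEig_sq_mul_exp_le hγ
  refine ⟨(A + B + π) / 2, by positivity, fun s hs => ?_⟩
  obtain ⟨δ, hδ, rfl⟩ : ∃ δ : ℝ, 0 < δ ∧ δ ^ 4 = s :=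
    ⟨s ^ (1 / 4 : ℝ), by positivity, by
      rw [← rpow_natCast, ← rpow_mul hs.le]; norm_num⟩
  have hsum : Summable fun k => |efkEig γ k ^ 2 * exp (-(efkEig γ k * δ ^ 4))| :=
    (summable_efkEig_pow_mul_exp hγ 2 hs).abs
  refine (integral_abs_tsum_cos_le hsum hδ (pow_pos hδ 9) (h δ hδ).1 (h δ hδ).2).trans (le_of_eq ?_)
  field_simp

/-- The sine coefficients on `(0,1)`. -/
noncomputable def sineCoeff (q : ℝ → ℝ) (k : ℕ) : ℝ :=
  2 * ∫ y in (0 : ℝ)..1, q y * sin ((k + 1) * π * y)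

/-- The smoothing bound `‖A² e^{-sA} q‖_∞ ≤ C s⁻² ‖q‖_∞`. -/
theorem exists_abs_tsum_efkEig_sq_mul_sineCoeff_le {γ : ℝ} (hγ : 0 < γ) :
    ∃ C > 0, ∀ s : ℝ, 0 < s → ∀ q : ℝ → ℝ, Continuous q → ∀ M : ℝ, (∀ y, |q y| ≤ M) → ∀ x : ℝ,
      |∑' k : ℕ, efkEig γ k ^ 2 * exp (-(efkEig γ k * s)) * sineCoeff q k * sin ((k + 1) * π * x)| ≤
        C * M / s ^ 2 := by
  obtain ⟨C, hC, h⟩ := exists_integral_abs_kernel_le hγ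
  refine ⟨C, hC, fun s hs q hq M hM x => ?_⟩
  set a : ℕ → ℝ := fun k => efkEig γ k ^ 2 * exp (-(efkEig γ k * s)) with ha
  have hsum : Summable fun k => |a k| := (summable_efkEig_pow_mul_exp hγ 2 hs).abs
  have hM0 : 0 ≤ M := (abs_nonneg _).trans (hM 0)
  set P : ℝ → ℝ := fun z => ∑' k : ℕ, a k * cos ((k + 1) * π * z) with hP
  have hb : ∀ k z, ‖a k * cos ((k + 1) * π * z)‖ ≤ |a k| := fun k z => by
    rw [norm_mul]
    exact mul_le_of_le_one_right (norm_nonneg _) (abs_cos_le_one _)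
  have hPc : Continuous P := continuous_tsum (fun k => by fun_prop) hsum hb
  have hPs : ∀ z, HasSum (fun k : ℕ => a k * cos ((k + 1) * π * z)) (P z) := fun z =>
    (Summable.of_norm_bounded hsum fun k => hb k z).hasSum
  have hPper : Function.Periodic (fun z => |P z|) 2 := fun z => by
    simp only [hP]
    congr 2
    funext k
    congr 1
    rw [show ((k : ℝ) + 1) * π * (z + 2) = (k + 1) * π * z + (k + 1 : ℕ) * (2 * π) by
      push_cast
      ring]
    exact cos_add_nat_mul_two_pi _ _
  have hprod : ∀ y, HasSum (fun k : ℕ => a k * (2 * (q y * sin ((k + 1) * π * y))) *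
      sin ((k + 1) * π * x)) (q y * (P (x - y) - P (x + y))) := fun y => by
    refine (((hPs (x - y)).sub (hPs (x + y))).mul_left (q y)).congr_fun fun k => ?_
    rw [mul_sub _ x y, mul_add _ x y, cos_sub, cos_add]
    ring
  have hInt := hasSum_intervalIntegral_of_bound
    (f := fun k y => a k * (2 * (q y * sin ((k + 1) * π * y))) * sin ((k + 1) * π * x))
    (b := fun k => |a k| * (2 * M)) (fun k => by fun_prop) (hsum.mul_right _) (fun k y => by
      rw [abs_mul, abs_mul (a k), abs_mul 2, abs_mul (q y), abs_two]
      have h1 := abs_sin_le_one ((k + 1) * π * y)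
      have h2 := abs_sin_le_one ((k + 1) * π * x)
      have h3 := hM y
      calc |a k| * (2 * (|q y| * |sin ((k + 1) * π * y)|)) * |sin ((k + 1) * π * x)|
          ≤ |a k| * (2 * (M * 1)) * 1 := by gcongr
        _ = _ := by ring) 0 1
  have hE : ∑' k : ℕ, a k * sineCoeff q k * sin ((k + 1) * π * x) =
      ∫ y in (0 : ℝ)..1, q y * (P (x - y) - P (x + y)) := by
    simp_rw [← fun y => (hprod y).tsum_eq]
    rw [← hInt.tsum_eq]
    congr 1
    funext k
    rw [intervalIntegral.integral_mul_const, intervalIntegral.integral_const_mul,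
      intervalIntegral.integral_const_mul, sineCoeff]
  rw [hE, ← Real.norm_eq_abs]
  refine (intervalIntegral.norm_integral_le_integral_norm zero_le_one).trans ?_
  have hle : ∀ y ∈ Icc (0 : ℝ) 1, ‖q y * (P (x - y) - P (x + y))‖ ≤
      M * (|P (x - y)| + |P (x + y)|) := fun y _ => by
    rw [norm_mul]
    exact mul_le_mul (hM y) (abs_sub _ _) (abs_nonneg _) hM0
  refine (intervalIntegral.integral_mono_on zero_le_one
    (Continuous.intervalIntegrable (by fun_prop) _ _)
    (Continuous.intervalIntegrable (by fun_prop) _ _) hle).trans ?_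
  rw [intervalIntegral.integral_const_mul, intervalIntegral.integral_add
    (Continuous.intervalIntegrable (by fun_prop) _ _)
    (Continuous.intervalIntegrable (by fun_prop) _ _),
    intervalIntegral.integral_comp_sub_left (fun z => |P z|),
    intervalIntegral.integral_comp_add_left (fun z => |P z|), sub_zero, add_zero,
    intervalIntegral.integral_add_adjacent_intervals (hPc.abs.intervalIntegrable _ _)
      (hPc.abs.intervalIntegrable _ _)]
  have h2 := hPper.intervalIntegral_add_eq (x - 1) (-1)
  rw [show x - 1 + 2 = x + 1 by ring, show (-1 : ℝ) + 2 = 1 by norm_num] at h2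
  rw [h2, mul_comm C, mul_div_assoc]
  exact mul_le_mul_of_nonneg_left (h s hs) hM0

/-- The bounded solution of `v' + l v = φ`. -/
noncomputable def duhamel (l : ℝ) (φ : ℝ → ℝ) (t : ℝ) : ℝ :=
  ∫ s in Ioi (0 : ℝ), exp (-(l * s)) * φ (t - s)

theorem integral_exp_neg_mul {l : ℝ} (hl : 0 < l) : ∫ s in Ioi (0 : ℝ), exp (-(l * s)) = 1 / l := by
  have := integral_exp_mul_Ioi (neg_lt_zero.2 hl) 0
  simp only [neg_mul, mul_zero, exp_zero] at this
  rw [this]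
  field_simp

theorem integrableOn_exp_neg_mul {l : ℝ} (hl : 0 < l) :
    MeasureTheory.IntegrableOn (fun s => exp (-(l * s))) (Ioi 0) := by
  simpa [neg_mul] using exp_neg_integrableOn_Ioi 0 hl

theorem integrableOn_exp_neg_mul_mul {l : ℝ} (hl : 0 < l) {φ : ℝ → ℝ} (hφ : Continuous φ) {C : ℝ}
    (hC : ∀ t, |φ t| ≤ C) : MeasureTheory.IntegrableOn (fun s => exp (-(l * s)) * φ s) (Ioi 0) := by
  refine MeasureTheory.Integrable.mono' ((integrableOn_exp_neg_mul hl).mul_const C)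
    (Continuous.aestronglyMeasurable (by fun_prop)) (Eventually.of_forall fun s => ?_)
  rw [norm_mul, Real.norm_eq_abs, abs_exp]
  exact mul_le_mul_of_nonneg_left (hC s) (exp_pos _).le

section Duhamel

variable {l C : ℝ} {φ ψ : ℝ → ℝ}

theorem abs_duhamel_le (hl : 0 < l) (hC : ∀ t, |φ t| ≤ C) (t : ℝ) : |duhamel l φ t| ≤ C / l := by
  have h := MeasureTheory.norm_integral_le_of_norm_le
    (((integrableOn_exp_neg_mul hl).mul_const C) : MeasureTheory.Integrable _ _)
    (f := fun s => exp (-(l * s)) * φ (t - s)) (Eventually.of_forall fun s => by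
      rw [norm_mul, Real.norm_eq_abs, abs_exp]
      exact mul_le_mul_of_nonneg_left (hC (t - s)) (exp_pos _).le)
  rw [MeasureTheory.integral_mul_const, integral_exp_neg_mul hl] at h
  refine h.trans (le_of_eq (by ring))

theorem duhamel_sub (hl : 0 < l) (hφ : Continuous φ) (hψ : Continuous ψ) (hC : ∀ t, |φ t| ≤ C)
    (hC' : ∀ t, |ψ t| ≤ C) (t : ℝ) :
    duhamel l (fun s => φ s - ψ s) t = duhamel l φ t - duhamel l ψ t := by
  unfold duhamel
  rw [← MeasureTheory.integral_sub
    (integrableOn_exp_neg_mul_mul hl (φ := fun s => φ (t - s)) (by fun_prop) fun s => hC _)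
    (integrableOn_exp_neg_mul_mul hl (φ := fun s => ψ (t - s)) (by fun_prop) fun s => hC' _)]
  simp_rw [mul_sub]

theorem duhamel_eq_integral_Iic (t : ℝ) :
    duhamel l φ t = exp (-(l * t)) * ∫ r in Iic t, exp (l * r) * φ r := by
  unfold duhamel
  rw [MeasureTheory.integral_Iic_eq_integral_Iio, ← MeasureTheory.integral_const_mul,
    ← MeasureTheory.integral_indicator measurableSet_Ioi,
    ← MeasureTheory.integral_indicator measurableSet_Iio,
    ← MeasureTheory.integral_sub_left_eq_self _ _ t]
  congr 1
  funext s
  simp only [indicator, mem_Ioi, mem_Iio]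
  by_cases h : s < t
  · rw [if_pos h, if_pos (by linarith), ← mul_assoc, ← exp_add]
    ring_nf
  · rw [if_neg h, if_neg (by linarith)]

theorem hasDerivAt_duhamel (hl : 0 < l) (hφ : Continuous φ) (hC : ∀ t, |φ t| ≤ C) (t : ℝ) :
    HasDerivAt (duhamel l φ) (φ t - l * duhamel l φ t) t := by
  have hInt : ∀ b, MeasureTheory.IntegrableOn (fun r => exp (l * r) * φ r) (Iic b) := fun b => by
    refine MeasureTheory.Integrable.mono' ((integrableOn_exp_mul_Iic hl b).mul_const C)
      (Continuous.aestronglyMeasurable (by fun_prop)) (Eventually.of_forall fun s => ?_)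
    rw [norm_mul, Real.norm_eq_abs, abs_exp]
    exact mul_le_mul_of_nonneg_left (hC s) (exp_pos _).le
  have hF : HasDerivAt (fun t => ∫ r in Iic t, exp (l * r) * φ r) (exp (l * t) * φ t) t := by
    have h1 : ∀ b, ∫ r in Iic b, exp (l * r) * φ r =
        (∫ r in Iic 0, exp (l * r) * φ r) + ∫ r in (0 : ℝ)..b, exp (l * r) * φ r := fun b => by
      rw [← intervalIntegral.integral_Iic_sub_Iic (hInt 0) (hInt b)]
      ring
    rw [funext h1]
    have hcont : Continuous fun r => exp (l * r) * φ r := by fun_prop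
    exact (intervalIntegral.integral_hasDerivAt_right (hcont.intervalIntegrable _ _)
      (hcont.stronglyMeasurableAtFilter _ _) hcont.continuousAt).const_add _
  have hE : HasDerivAt (fun t => exp (-(l * t))) (-(l * exp (-(l * t)))) t := by
    have := ((hasDerivAt_id t).const_mul l).neg.exp
    refine this.congr_deriv ?_
    simp only [Pi.neg_apply, id_eq, mul_one]
    ring
  have h := hE.mul hF
  have e : duhamel l φ = fun t => exp (-(l * t)) * ∫ r in Iic t, exp (l * r) * φ r :=
    funext duhamel_eq_integral_Iic
  rw [e]
  refine h.congr_deriv ?_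
  rw [← mul_assoc (exp (-(l * t))), ← exp_add, neg_add_cancel, exp_zero]
  ring

theorem abs_deriv_duhamel_le (hl : 0 < l) (hC : ∀ t, |φ t| ≤ C) (t : ℝ) :
    |φ t - l * duhamel l φ t| ≤ 2 * C := by
  have h1 := hC t
  have h2 := abs_duhamel_le hl hC t
  rw [le_div_iff₀ hl] at h2
  calc |φ t - l * duhamel l φ t| ≤ |φ t| + |l * duhamel l φ t| := abs_sub _ _
    _ = |φ t| + |duhamel l φ t| * l := by rw [abs_mul, abs_of_pos hl, mul_comm l]
    _ ≤ 2 * C := by linarith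

theorem abs_duhamel_sub_le (hl : 0 < l) (hφ : Continuous φ) (hC : ∀ t, |φ t| ≤ C) (t t' : ℝ) :
    |duhamel l φ t - duhamel l φ t'| ≤ 2 * C * √|t - t'| / √l := by
  have hC0 : 0 ≤ C := (abs_nonneg _).trans (hC 0)
  have h1 : |duhamel l φ t - duhamel l φ t'| ≤ 2 * C / l := by
    have a1 := abs_duhamel_le hl hC t
    have a2 := abs_duhamel_le hl hC t'
    have := abs_sub (duhamel l φ t) (duhamel l φ t')
    rw [two_mul, add_div]
    linarith
  have h2 : |duhamel l φ t - duhamel l φ t'| ≤ 2 * C * |t - t'| :=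
    Convex.norm_image_sub_le_of_norm_hasDerivWithin_le (s := univ)
      (fun x _ => (hasDerivAt_duhamel hl hφ hC x).hasDerivWithinAt)
      (fun x _ => abs_deriv_duhamel_le hl hC x) convex_univ (mem_univ _) (mem_univ _)
  have h3 : |duhamel l φ t - duhamel l φ t'| ^ 2 ≤ (2 * C * √|t - t'| / √l) ^ 2 := by
    rw [div_pow, mul_pow, sq_sqrt (abs_nonneg _), sq_sqrt hl.le, sq]
    refine (mul_le_mul h1 h2 (abs_nonneg _) (by positivity)).trans (le_of_eq ?_)
    ring
  exact (sq_le_sq₀ (abs_nonneg _) (by positivity)).1 h3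

theorem deriv_duhamel_eq_integral (hl : 0 < l) (hφ : Continuous φ) (hC : ∀ t, |φ t| ≤ C) (t : ℝ) :
    φ t - l * duhamel l φ t = ∫ s in Ioi (0 : ℝ), l * exp (-(l * s)) * (φ t - φ (t - s)) := by
  have h1 := (integrableOn_exp_neg_mul hl).mul_const (φ t)
  have h2 := integrableOn_exp_neg_mul_mul hl (φ := fun s => φ (t - s)) (by fun_prop) fun s => hC _
  simp_rw [mul_assoc]
  rw [MeasureTheory.integral_const_mul]
  simp_rw [mul_sub]
  rw [MeasureTheory.integral_sub h1 h2, MeasureTheory.integral_mul_const, integral_exp_neg_mul hl]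
  unfold duhamel
  field_simp

end Duhamel

theorem continuous_sineCoeff {h : ℝ → ℝ → ℝ} (hc : Continuous fun p : ℝ × ℝ => h p.1 p.2) (k : ℕ) :
    Continuous fun t => sineCoeff (h t) k := by
  unfold sineCoeff
  refine continuous_const.mul (intervalIntegral.continuous_parametric_intervalIntegral_of_continuous'
    (f := fun t y => h t y * sin ((k + 1) * π * y)) ?_ 0 1)
  exact hc.mul (by fun_prop)

theorem sineCoeff_sub {p q : ℝ → ℝ} (hp : Continuous p) (hq : Continuous q) (k : ℕ) :
    sineCoeff (fun y => p y - q y) k = sineCoeff p k - sineCoeff q k := by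
  unfold sineCoeff
  simp_rw [sub_mul]
  rw [intervalIntegral.integral_sub (Continuous.intervalIntegrable (by fun_prop) _ _)
    (Continuous.intervalIntegrable (by fun_prop) _ _), mul_sub]

theorem sineCoeff_add {p q : ℝ → ℝ} (hp : Continuous p) (hq : Continuous q) (k : ℕ) :
    sineCoeff (fun y => p y + q y) k = sineCoeff p k + sineCoeff q k := by
  unfold sineCoeff
  simp_rw [add_mul]
  rw [intervalIntegral.integral_add (Continuous.intervalIntegrable (by fun_prop) _ _)
    (Continuous.intervalIntegrable (by fun_prop) _ _), mul_add]

theorem abs_sineCoeff_le {q : ℝ → ℝ} {M : ℝ} (hM : ∀ y ∈ Icc (0 : ℝ) 1, |q y| ≤ M) (k : ℕ) :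
    |sineCoeff q k| ≤ 2 * M := by
  unfold sineCoeff
  rw [abs_mul, abs_two]
  refine mul_le_mul_of_nonneg_left ?_ zero_le_two
  have := intervalIntegral.norm_integral_le_of_norm_le_const (a := (0 : ℝ)) (b := 1) (C := M)
    (f := fun y => q y * sin ((k + 1) * π * y)) fun y hy => by
      rw [uIoc_of_le zero_le_one] at hy
      rw [norm_mul]
      exact (mul_le_of_le_one_right (norm_nonneg _) (abs_sin_le_one _)).trans
        (hM y (Ioc_subset_Icc_self hy))
  simpa using this

/-- Bessel's inequality for sine coefficients. -/
theorem sum_sineCoeff_sq_le {q : ℝ → ℝ} (hq : Continuous q) (N : ℕ) :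
    ∑ k ∈ Finset.range N, sineCoeff q k ^ 2 ≤ 2 * ∫ y in (0 : ℝ)..1, q y ^ 2 := by
  set S : ℝ → ℝ := fun y => ∑ k ∈ Finset.range N, sineCoeff q k * sin ((k + 1) * π * y) with hS
  have hSc : Continuous S := by fun_prop
  have hcoef : ∀ k : ℕ, ∫ y in (0 : ℝ)..1, q y * sin ((k + 1) * π * y) = sineCoeff q k / 2 :=
      fun k => by
    unfold sineCoeff; ring
  have h1 : ∫ y in (0 : ℝ)..1, q y * S y = ∑ k ∈ Finset.range N, sineCoeff q k ^ 2 / 2 := by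
    simp only [hS, Finset.mul_sum]
    rw [intervalIntegral.integral_finsetSum fun k _ =>
      Continuous.intervalIntegrable (by fun_prop) _ _]
    refine Finset.sum_congr rfl fun k _ => ?_
    simp_rw [mul_left_comm (q _)]
    rw [intervalIntegral.integral_const_mul, hcoef]
    ring
  have h2 : ∫ y in (0 : ℝ)..1, S y * S y = ∑ k ∈ Finset.range N, sineCoeff q k ^ 2 / 2 := by
    have e : ∀ y, S y * S y = ∑ i ∈ Finset.range N, ∑ j ∈ Finset.range N,
        sineCoeff q i * sineCoeff q j * (sin ((i + 1) * π * y) * sin ((j + 1) * π * y)) :=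
            fun y => by
      simp only [hS, Finset.sum_mul_sum]
      refine Finset.sum_congr rfl fun i _ => Finset.sum_congr rfl fun j _ => by ring
    simp_rw [e]
    rw [intervalIntegral.integral_finsetSum fun k _ =>
      Continuous.intervalIntegrable (by fun_prop) _ _]
    refine Finset.sum_congr rfl fun i hi => ?_
    rw [intervalIntegral.integral_finsetSum fun k _ =>
      Continuous.intervalIntegrable (by fun_prop) _ _, Finset.sum_eq_single i]
    · rw [intervalIntegral.integral_const_mul, integral_sin_mul_sin, if_pos rfl]
      ring
    · intro j _ hj
      rw [intervalIntegral.integral_const_mul, integral_sin_mul_sin, if_neg hj.symm, mul_zero]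
    · exact fun h => absurd hi h
  have h3 : 0 ≤ ∫ y in (0 : ℝ)..1, (q y - S y) ^ 2 :=
    intervalIntegral.integral_nonneg zero_le_one fun _ _ => sq_nonneg _
  have h4 : ∫ y in (0 : ℝ)..1, (q y - S y) ^ 2 = (∫ y in (0 : ℝ)..1, q y ^ 2) -
      2 * (∫ y in (0 : ℝ)..1, q y * S y) + ∫ y in (0 : ℝ)..1, S y * S y := by
    rw [← intervalIntegral.integral_const_mul, ← intervalIntegral.integral_sub
      (Continuous.intervalIntegrable (by fun_prop) _ _)
      (Continuous.intervalIntegrable (by fun_prop) _ _), ← intervalIntegral.integral_add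
      (Continuous.intervalIntegrable (by fun_prop) _ _)
      (Continuous.intervalIntegrable (by fun_prop) _ _)]
    congr 1
    funext y
    ring
  rw [h4, h1, h2, ← Finset.sum_div] at h3
  linarith

theorem abs_sineCoeff_le_of_integral_sq_le {q : ℝ → ℝ} (hq : Continuous q) {M : ℝ}
    (hM : ∫ y in (0 : ℝ)..1, q y ^ 2 ≤ M) (k : ℕ) : |sineCoeff q k| ≤ 2 * M + 1 := by
  have h := sum_sineCoeff_sq_le hq (k + 1)
  have h2 : sineCoeff q k ^ 2 ≤ ∑ k ∈ Finset.range (k + 1), sineCoeff q k ^ 2 :=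
    Finset.single_le_sum (f := fun k => sineCoeff q k ^ 2) (fun _ _ => sq_nonneg _)
      (Finset.self_mem_range_succ k)
  rw [← sq_abs] at h2
  nlinarith [sq_nonneg (|sineCoeff q k| - 1), abs_nonneg (sineCoeff q k)]

/-- Sine coefficients of the bounded solution of `∂ₜu + γ ∂ₓ⁴u - ∂ₓ²u - u = h`. -/
noncomputable def efkCoeff (γ : ℝ) (h : ℝ → ℝ → ℝ) (k : ℕ) (t : ℝ) : ℝ :=
  duhamel (efkEig γ k) (fun s => sineCoeff (h s) k) t

/-- The bounded solution of `∂ₜu + γ ∂ₓ⁴u - ∂ₓ²u - u = h`, as a sine series. -/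
noncomputable def efkSol (γ : ℝ) (h : ℝ → ℝ → ℝ) (t x : ℝ) : ℝ :=
  ∑' k : ℕ, efkCoeff γ h k t * sin ((k + 1) * π * x)

theorem summable_one_div_succ_sq : Summable fun k : ℕ => 1 / ((k : ℝ) + 1) ^ 2 := by
  have := (summable_nat_add_iff (f := fun k : ℕ => 1 / (k : ℝ) ^ 2) 1).2
    (Real.summable_one_div_nat_pow.2 one_lt_two)
  simpa using this

section Summability

variable {γ : ℝ}

theorem summable_succ_sq_div_efkEig (hγ : 0 < γ) :
    Summable fun k : ℕ => ((k : ℝ) + 1) ^ 2 / efkEig γ k := by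
  refine Summable.of_nonneg_of_le (fun k => ?_) (fun k => ?_)
    (summable_one_div_succ_sq.mul_left (1 / (γ * π ^ 4)))
  · have := efkEig_pos hγ k
    positivity
  · rw [div_mul_div_comm, one_mul, div_le_div_iff₀ (efkEig_pos hγ k) (by positivity)]
    have := le_efkEig γ k
    nlinarith

theorem summable_succ_div_efkEig (hγ : 0 < γ) :
    Summable fun k : ℕ => ((k : ℝ) + 1) / efkEig γ k := by
  refine Summable.of_nonneg_of_le (fun k => ?_) (fun k => ?_) (summable_succ_sq_div_efkEig hγ)
  · have := efkEig_pos hγ k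
    positivity
  · have := efkEig_pos hγ k
    gcongr
    nlinarith [(Nat.cast_nonneg k : (0 : ℝ) ≤ k)]

theorem summable_one_div_efkEig (hγ : 0 < γ) : Summable fun k : ℕ => 1 / efkEig γ k := by
  refine Summable.of_nonneg_of_le (fun k => ?_) (fun k => ?_) (summable_succ_div_efkEig hγ)
  · have := efkEig_pos hγ k
    positivity
  · have := efkEig_pos hγ k
    gcongr
    linarith [(Nat.cast_nonneg k : (0 : ℝ) ≤ k)]

theorem summable_one_div_sqrt_efkEig (hγ : 0 < γ) :
    Summable fun k : ℕ => 1 / √(efkEig γ k) := by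
  refine Summable.of_nonneg_of_le (fun k => by positivity) (fun k => ?_)
    (summable_one_div_succ_sq.mul_left (1 / √(γ * π ^ 4)))
  rw [div_mul_div_comm, one_mul]
  refine div_le_div_of_nonneg_left zero_le_one (by positivity) ?_
  refine Real.le_sqrt_of_sq_le ?_
  rw [mul_pow, sq_sqrt (by positivity), ← pow_mul]
  exact le_efkEig γ k

end Summability

section Sol

variable {γ C₀ : ℝ} {h : ℝ → ℝ → ℝ}

theorem abs_efkCoeff_le (hγ : 0 < γ) (hC₀ : ∀ t k, |sineCoeff (h t) k| ≤ C₀) (k : ℕ) (t : ℝ) :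
    |efkCoeff γ h k t| ≤ C₀ / efkEig γ k :=
  abs_duhamel_le (efkEig_pos hγ k) (fun s => hC₀ s k) t

theorem summable_efkCoeff_bound (hγ : 0 < γ) (C₀ : ℝ) : Summable fun k => C₀ / efkEig γ k := by
  simpa only [mul_one_div] using (summable_one_div_efkEig hγ).mul_left C₀

theorem summable_abs_efkCoeff (hγ : 0 < γ) (hC₀ : ∀ t k, |sineCoeff (h t) k| ≤ C₀) (t : ℝ) :
    Summable fun k => |efkCoeff γ h k t| :=
  Summable.of_nonneg_of_le (fun _ => abs_nonneg _) (fun k => abs_efkCoeff_le hγ hC₀ k t)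
    (summable_efkCoeff_bound hγ C₀)

theorem summable_efkSol (hγ : 0 < γ) (hC₀ : ∀ t k, |sineCoeff (h t) k| ≤ C₀) (t x : ℝ) :
    Summable fun k : ℕ => efkCoeff γ h k t * sin ((k + 1) * π * x) :=
  Summable.of_norm_bounded (summable_abs_efkCoeff hγ hC₀ t) fun k => by
    rw [norm_mul]
    exact mul_le_of_le_one_right (norm_nonneg _) (abs_sin_le_one _)

theorem hasDerivAt_efkCoeff (hγ : 0 < γ) (hc : Continuous fun p : ℝ × ℝ => h p.1 p.2)
    (hC₀ : ∀ t k, |sineCoeff (h t) k| ≤ C₀) (k : ℕ) (t : ℝ) :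
    HasDerivAt (efkCoeff γ h k) (sineCoeff (h t) k - efkEig γ k * efkCoeff γ h k t) t :=
  hasDerivAt_duhamel (efkEig_pos hγ k) (continuous_sineCoeff hc k) (fun s => hC₀ s k) t

theorem abs_efkSol_le (hγ : 0 < γ) (hC₀ : ∀ t k, |sineCoeff (h t) k| ≤ C₀) (t x : ℝ) :
    |efkSol γ h t x| ≤ C₀ * ∑' k, 1 / efkEig γ k := by
  have hs := (summable_one_div_efkEig hγ).mul_left C₀
  rw [← Real.norm_eq_abs, ← tsum_mul_left]
  refine tsum_of_norm_bounded hs.hasSum fun k => ?_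
  rw [norm_mul, mul_one_div]
  exact (mul_le_of_le_one_right (norm_nonneg _) (abs_sin_le_one _)).trans
      (abs_efkCoeff_le hγ hC₀ k t)

theorem exists_abs_efkSol_sub_le (hγ : 0 < γ) : ∃ C > 0, ∀ (h : ℝ → ℝ → ℝ) (C₀ : ℝ),
    (Continuous fun p : ℝ × ℝ => h p.1 p.2) → (∀ t k, |sineCoeff (h t) k| ≤ C₀) →
    ∀ t x t' x', |efkSol γ h t x - efkSol γ h t' x'| ≤ C * C₀ * (√|t - t'| + |x - x'|) := by
  have s1 := summable_one_div_sqrt_efkEig hγ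
  have s2 := summable_succ_div_efkEig hγ
  set A := ∑' k, 1 / √(efkEig γ k)
  set B := ∑' k : ℕ, ((k : ℝ) + 1) / efkEig γ k
  have hA : 0 ≤ A := tsum_nonneg fun k => by positivity
  have hB : 0 ≤ B := tsum_nonneg fun k => by have := efkEig_pos hγ k; positivity
  refine ⟨2 * A + π * B + 1, by positivity, fun h C₀ hc hC₀ t x t' x' => ?_⟩
  have hC₀' : 0 ≤ C₀ := (abs_nonneg _).trans (hC₀ 0 0)
  have hs := (s1.mul_left (2 * C₀ * √|t - t'|)).add (s2.mul_left (C₀ * π * |x - x'|))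
  have key : |efkSol γ h t x - efkSol γ h t' x'| ≤
      2 * C₀ * √|t - t'| * A + C₀ * π * |x - x'| * B := by
    unfold efkSol
    rw [← (summable_efkSol hγ hC₀ t x).tsum_sub (summable_efkSol hγ hC₀ t' x'), ← Real.norm_eq_abs]
    have e : 2 * C₀ * √|t - t'| * A + C₀ * π * |x - x'| * B = ∑' k : ℕ,
      (2 * C₀ * √|t - t'| * (1 / √(efkEig γ k)) +
        C₀ * π * |x - x'| * (((k : ℝ) + 1) / efkEig γ k)) := by
      rw [(s1.mul_left _).tsum_add (s2.mul_left _), tsum_mul_left, tsum_mul_left]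
    rw [e]
    refine tsum_of_norm_bounded hs.hasSum fun k => ?_
    have e1 : efkCoeff γ h k t * sin ((k + 1) * π * x) -
        efkCoeff γ h k t' * sin ((k + 1) * π * x') =
      (efkCoeff γ h k t - efkCoeff γ h k t') * sin ((k + 1) * π * x) +
        efkCoeff γ h k t' * (sin ((k + 1) * π * x) - sin ((k + 1) * π * x')) := by ring
    rw [e1]
    refine (norm_add_le _ _).trans (add_le_add ?_ ?_)
    · rw [norm_mul, mul_one_div]
      exact (mul_le_of_le_one_right (norm_nonneg _) (abs_sin_le_one _)).trans
        (abs_duhamel_sub_le (efkEig_pos hγ k) (continuous_sineCoeff hc k) (fun s => hC₀ s k) t t')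
    · rw [norm_mul]
      have h1 := abs_efkCoeff_le hγ hC₀ k t'
      have h2 := Real.abs_sin_sub_sin_le ((k + 1) * π * x) ((k + 1) * π * x')
      rw [← mul_sub, abs_mul, abs_of_nonneg (by positivity : 0 ≤ ((k : ℝ) + 1) * π)] at h2
      refine (mul_le_mul h1 h2 (abs_nonneg _) ((abs_nonneg _).trans h1)).trans (le_of_eq ?_)
      ring
  refine key.trans ?_
  have n1 : 0 ≤ C₀ * √|t - t'| * (π * B + 1) := by positivity
  have n2 : 0 ≤ C₀ * |x - x'| * (2 * A + 1) := by positivity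
  nlinarith

theorem continuous_efkSol (hγ : 0 < γ) (hc : Continuous fun p : ℝ × ℝ => h p.1 p.2)
    (hC₀ : ∀ t k, |sineCoeff (h t) k| ≤ C₀) : Continuous fun p : ℝ × ℝ => efkSol γ h p.1 p.2 := by
  refine continuous_tsum (fun k => ?_) (summable_efkCoeff_bound hγ C₀) fun k p => ?_
  · have : Continuous (efkCoeff γ h k) := continuous_iff_continuousAt.2 fun t =>
      (hasDerivAt_efkCoeff hγ hc hC₀ k t).continuousAt
    fun_prop
  · rw [norm_mul]
    exact (mul_le_of_le_one_right (norm_nonneg _) (abs_sin_le_one _)).trans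
      (abs_efkCoeff_le hγ hC₀ k p.1)

theorem efkSol_periodic {ω : ℝ} (hper : ∀ t, h (t + ω) = h t) (t x : ℝ) :
    efkSol γ h (t + ω) x = efkSol γ h t x := by
  unfold efkSol efkCoeff duhamel
  simp_rw [add_sub_right_comm, hper]

theorem abs_efkSol_sub_le (hγ : 0 < γ) {h' : ℝ → ℝ → ℝ} {C₀' d : ℝ}
    (hc : Continuous fun p : ℝ × ℝ => h p.1 p.2) (hc' : Continuous fun p : ℝ × ℝ => h' p.1 p.2)
    (hC₀ : ∀ t k, |sineCoeff (h t) k| ≤ C₀) (hC₀' : ∀ t k, |sineCoeff (h' t) k| ≤ C₀')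
    (hd : ∀ t k, |sineCoeff (h t) k - sineCoeff (h' t) k| ≤ d) (t x : ℝ) :
    |efkSol γ h t x - efkSol γ h' t x| ≤ d * ∑' k, 1 / efkEig γ k := by
  have hs := (summable_one_div_efkEig hγ).mul_left d
  unfold efkSol
  rw [← (summable_efkSol hγ hC₀ t x).tsum_sub (summable_efkSol hγ hC₀' t x), ← Real.norm_eq_abs,
    ← tsum_mul_left]
  refine tsum_of_norm_bounded hs.hasSum fun k => ?_
  rw [← sub_mul, norm_mul, mul_one_div]
  refine (mul_le_of_le_one_right (norm_nonneg _) (abs_sin_le_one _)).trans ?_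
  unfold efkCoeff
  rw [← duhamel_sub (C := max C₀ C₀') (efkEig_pos hγ k) (continuous_sineCoeff hc k)
    (continuous_sineCoeff hc' k)
    (fun s => (hC₀ s k).trans (le_max_left _ _)) (fun s => (hC₀' s k).trans (le_max_right _ _))]
  exact abs_duhamel_le (efkEig_pos hγ k) (fun s => hd s k) t

/-- Energy bound: `sup_t ‖u(t)‖_{L²} ≤ λ₀⁻¹ sup_t ‖h(t)‖_{L²}`. -/
theorem integral_efkSol_sq_le (hγ : 0 < γ) (hc : Continuous fun p : ℝ × ℝ => h p.1 p.2) {R : ℝ}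
    (hR : ∀ t, ∫ y in (0 : ℝ)..1, h t y ^ 2 ≤ efkEig γ 0 ^ 2 * R) (t : ℝ) :
    ∫ y in (0 : ℝ)..1, efkSol γ h t y ^ 2 ≤ R := by
  have hcoef : ∀ t k, |sineCoeff (h t) k| ≤ 2 * (efkEig γ 0 ^ 2 * R) + 1 := fun t k =>
    abs_sineCoeff_le_of_integral_sq_le (hc.comp (Continuous.prodMk_right t)) (hR t) k
  set l := efkEig γ 0 with hl
  have hlpos : 0 < l := efkEig_pos hγ 0
  have hpars := hasSum_sq_of_orthogonal (e := fun (k : ℕ) z => sin ((k + 1) * π * z))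
    (fun k => by fun_prop) (fun k z => abs_sin_le_one _) integral_sin_mul_sin
    (summable_abs_efkCoeff hγ hcoef t)
  change HasSum _ (∫ y in (0 : ℝ)..1, efkSol γ h t y ^ 2) at hpars
  refine le_of_tendsto' hpars.tendsto_sum_nat fun N => ?_
  set a : ℕ → ℝ := fun k => efkCoeff γ h k t with ha
  set A := ∑ k ∈ Finset.range N, a k ^ 2 with hA
  have hcs : ∀ k, Continuous fun s => sineCoeff (h (t - s)) k := fun k =>
    (continuous_sineCoeff hc k).comp (continuous_const.sub continuous_id)
  have hInt : ∀ k, MeasureTheory.IntegrableOn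
      (fun s => exp (-(efkEig γ k * s)) * sineCoeff (h (t - s)) k) (Ioi 0) := fun k =>
    integrableOn_exp_neg_mul_mul (efkEig_pos hγ k) (hcs k) fun s => hcoef (t - s) k
  have h1 : A = ∫ s in Ioi (0 : ℝ), ∑ k ∈ Finset.range N,
      a k * (exp (-(efkEig γ k * s)) * sineCoeff (h (t - s)) k) := by
    rw [MeasureTheory.integral_finsetSum _ fun k _ => (hInt k).const_mul (a k)]
    refine Finset.sum_congr rfl fun k _ => ?_
    rw [MeasureTheory.integral_const_mul, sq]
    rfl
  have h2 : A ≤ ∫ s in Ioi (0 : ℝ), exp (-(l * s)) * (l / 2 * A + l * R) := by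
    refine h1.le.trans ?_
    refine MeasureTheory.setIntegral_mono_on
      (MeasureTheory.integrable_finsetSum _ fun k _ => (hInt k).const_mul (a k))
      ((integrableOn_exp_neg_mul hlpos).mul_const _) measurableSet_Ioi fun s hs => ?_
    have hB := (sum_sineCoeff_sq_le (hc.comp (Continuous.prodMk_right (t - s))) N).trans
      (mul_le_mul_of_nonneg_left (hR (t - s)) zero_le_two)
    calc ∑ k ∈ Finset.range N, a k * (exp (-(efkEig γ k * s)) * sineCoeff (h (t - s)) k)
        ≤ ∑ k ∈ Finset.range N, exp (-(l * s)) *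
          (l / 2 * a k ^ 2 + 1 / (2 * l) * sineCoeff (h (t - s)) k ^ 2) := by
          refine Finset.sum_le_sum fun k _ => ?_
          have e1 : exp (-(efkEig γ k * s)) ≤ exp (-(l * s)) := exp_le_exp.2 (by
            have := mul_le_mul_of_nonneg_right (efkEig_mono hγ (Nat.zero_le k)) (le_of_lt hs)
            linarith)
          have e2 : |a k * sineCoeff (h (t - s)) k| ≤
              l / 2 * a k ^ 2 + 1 / (2 * l) * sineCoeff (h (t - s)) k ^ 2 := by
            rw [abs_mul, ← sq_abs (a k), ← sq_abs (sineCoeff _ _)]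
            have : 0 ≤ (l * |a k| - |sineCoeff (h (t - s)) k|) ^ 2 / (2 * l) := by positivity
            have e : (l * |a k| - |sineCoeff (h (t - s)) k|) ^ 2 / (2 * l) =
              l / 2 * |a k| ^ 2 + 1 / (2 * l) * |sineCoeff (h (t - s)) k| ^ 2 -
                |a k| * |sineCoeff (h (t - s)) k| := by field_simp; ring
            linarith
          calc a k * (exp (-(efkEig γ k * s)) * sineCoeff (h (t - s)) k)
              = exp (-(efkEig γ k * s)) * (a k * sineCoeff (h (t - s)) k) := by ring
            _ ≤ exp (-(efkEig γ k * s)) * |a k * sineCoeff (h (t - s)) k| := by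
              gcongr; exact le_abs_self _
            _ ≤ _ := mul_le_mul e1 e2 (abs_nonneg _) (exp_pos _).le
      _ = exp (-(l * s)) * (l / 2 * A +
          1 / (2 * l) * ∑ k ∈ Finset.range N, sineCoeff (h (t - s)) k ^ 2) := by
          rw [← Finset.mul_sum, Finset.sum_add_distrib, ← Finset.mul_sum, ← Finset.mul_sum]
      _ ≤ exp (-(l * s)) * (l / 2 * A + l * R) := by
          refine mul_le_mul_of_nonneg_left ?_ (exp_pos _).le
          have := mul_le_mul_of_nonneg_left hB (by positivity : 0 ≤ 1 / (2 * l))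
          have e : 1 / (2 * l) * (2 * (l ^ 2 * R)) = l * R := by field_simp
          rw [e] at this
          exact add_le_add_right this _
  rw [MeasureTheory.integral_mul_const, integral_exp_neg_mul hlpos] at h2
  have e : 1 / l * (l / 2 * A + l * R) = A / 2 + R := by field_simp
  rw [e] at h2
  rw [← Finset.mul_sum]
  linarith

end Sol

theorem abs_sub_le_of_abs_deriv_le_deriv {f f' B B' : ℝ → ℝ} {a b : ℝ} (hab : a ≤ b)
    (hf : ∀ x ∈ Icc a b, HasDerivAt f (f' x) x) (hB : ∀ x ∈ Icc a b, HasDerivAt B (B' x) x)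
    (h : ∀ x ∈ Icc a b, |f' x| ≤ B' x) : |f b - f a| ≤ B b - B a := by
  have h1 : ∀ x ∈ Icc a b, HasDerivAt (fun x => f x - f a) (f' x) x := fun x hx =>
    (hf x hx).sub_const _
  have h2 : ∀ x ∈ Icc a b, HasDerivAt (fun x => B x - B a) (B' x) x := fun x hx =>
    (hB x hx).sub_const _
  exact image_norm_le_of_norm_deriv_right_le_deriv_boundary' (f := fun x => f x - f a)
    (B := fun x => B x - B a) (fun x hx => (h1 x hx).continuousAt.continuousWithinAt)
    (fun x hx => (h1 x (Ico_subset_Icc_self hx)).hasDerivWithinAt) (by simp)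
    (fun x hx => (h2 x hx).continuousAt.continuousWithinAt)
    (fun x hx => (h2 x (Ico_subset_Icc_self hx)).hasDerivWithinAt)
    (fun x hx => h x (Ico_subset_Icc_self hx)) (right_mem_Icc.2 hab)

theorem integral_add_rpow {ε θ : ℝ} (hε : 0 < ε) (hθ : θ < 1) :
    MeasureTheory.IntegrableOn (fun s => (s + ε) ^ (θ - 2)) (Ioi 0) ∧
    ∫ s in Ioi (0 : ℝ), (s + ε) ^ (θ - 2) = ε ^ (θ - 1) / (1 - θ) := by
  have h1 : ∀ s ∈ Ici (0 : ℝ),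
      HasDerivAt (fun s => -(s + ε) ^ (θ - 1) / (1 - θ)) ((s + ε) ^ (θ - 2)) s := fun s hs => by
    have hs' : s + ε ≠ 0 := by
      have : (0 : ℝ) ≤ s := hs
      positivity
    have := ((((hasDerivAt_id s).add_const ε).rpow_const (p := θ - 1) (Or.inl hs')).neg).div_const
      (1 - θ)
    refine this.congr_deriv ?_
    rw [show θ - 1 - 1 = θ - 2 by ring]
    have : 1 - θ ≠ 0 := by linarith
    simp only [id_eq]
    field_simp
    ring
  have h2 : ∀ s ∈ Ioi (0 : ℝ), 0 ≤ (s + ε) ^ (θ - 2) := fun s hs => by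
    have : (0 : ℝ) < s := hs
    positivity
  have h3 : Tendsto (fun s => -(s + ε) ^ (θ - 1) / (1 - θ)) atTop (𝓝 0) := by
    have := (tendsto_rpow_neg_atTop (y := 1 - θ) (by linarith)).comp
      (tendsto_atTop_add_const_right atTop ε tendsto_id)
    have := (this.neg).div_const (1 - θ)
    simpa [Function.comp_def] using this
  refine ⟨MeasureTheory.integrableOn_Ioi_deriv_of_nonneg' h1 h2 h3, ?_⟩
  rw [MeasureTheory.integral_Ioi_of_hasDerivAt_of_nonneg' h1 h2 h3]
  simp
  ring

section TimeDerivative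

variable {γ : ℝ} {h : ℝ → ℝ → ℝ}

/-- Sine coefficients of the time derivative of `efkSol`. -/
noncomputable def efkCoeffDeriv (γ : ℝ) (h : ℝ → ℝ → ℝ) (k : ℕ) (t : ℝ) : ℝ :=
  sineCoeff (h t) k - efkEig γ k * efkCoeff γ h k t

/-- `A e^{-εA} ∂ₜu` is controlled through the Hölder exponent of the source. -/
theorem exists_abs_tsum_efkEig_mul_efkCoeffDeriv_le (hγ : 0 < γ)
    (hc : Continuous fun p : ℝ × ℝ => h p.1 p.2) {M : ℝ} (hM : ∀ t x, |h t x| ≤ M) {L θ : ℝ}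
    (hL : 0 < L) (hθ : 0 < θ) (hθ1 : θ < 1)
    (hH : ∀ t s x, |h t x - h s x| ≤ L * |t - s| ^ θ) :
    ∃ D > 0, ∀ ε : ℝ, 0 < ε → ∀ t x,
      |∑' k : ℕ, efkEig γ k * exp (-(efkEig γ k * ε)) * efkCoeffDeriv γ h k t *
        sin ((k + 1) * π * x)| ≤ D * ε ^ (θ - 1) := by
  obtain ⟨C, hC, hker⟩ := exists_abs_tsum_efkEig_sq_mul_sineCoeff_le hγ
  have h1θ : 0 < 1 - θ := by linarith
  refine ⟨C * L / (1 - θ), by positivity, fun ε hε t x => ?_⟩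
  have hcoef : ∀ t k, |sineCoeff (h t) k| ≤ 2 * M := fun t => abs_sineCoeff_le fun y _ => hM t y
  have hM0 : 0 ≤ M := (abs_nonneg _).trans (hM 0 0)
  have hct : ∀ s, Continuous (h s) := fun s => hc.comp (Continuous.prodMk_right s)
  set F : ℕ → ℝ → ℝ := fun k s => efkEig γ k * exp (-(efkEig γ k * ε)) *
    (efkEig γ k * exp (-(efkEig γ k * s)) * (sineCoeff (h t) k - sineCoeff (h (t - s)) k)) *
      sin ((k + 1) * π * x) with hF
  have hscont : ∀ k, Continuous fun s => sineCoeff (h (t - s)) k := fun k =>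
    (continuous_sineCoeff hc k).comp (continuous_const.sub continuous_id)
  have hFc : ∀ k, Continuous (F k) := fun k => by
    have := hscont k
    fun_prop
  have hFb : ∀ k s, ‖F k s‖ ≤ exp (-(efkEig γ k * s)) *
      (efkEig γ k ^ 2 * exp (-(efkEig γ k * ε)) * (4 * M)) := fun k s => by
    have hpos := efkEig_pos hγ k
    have b1 : |sineCoeff (h t) k - sineCoeff (h (t - s)) k| ≤ 4 * M := by
      have := abs_sub (sineCoeff (h t) k) (sineCoeff (h (t - s)) k)
      linarith [hcoef t k, hcoef (t - s) k]
    have b2 := abs_sin_le_one ((k + 1) * π * x)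
    simp only [hF]
    rw [Real.norm_eq_abs, abs_mul, abs_mul, abs_mul, abs_mul, abs_mul, abs_exp, abs_exp,
      abs_of_pos hpos]
    calc _ ≤ efkEig γ k * exp (-(efkEig γ k * ε)) *
            (efkEig γ k * exp (-(efkEig γ k * s)) * (4 * M)) * 1 := by gcongr
      _ = _ := by ring
  have hFi : ∀ k, MeasureTheory.Integrable (F k) (MeasureTheory.volume.restrict (Ioi 0)) := fun k =>
    MeasureTheory.Integrable.mono' ((integrableOn_exp_neg_mul (efkEig_pos hγ k)).mul_const _)
      (hFc k).aestronglyMeasurable (Eventually.of_forall (hFb k))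
  have hsum : Summable fun k => ∫ s in Ioi (0 : ℝ), ‖F k s‖ := by
    refine Summable.of_nonneg_of_le
      (fun k => MeasureTheory.integral_nonneg fun _ => norm_nonneg _) (fun k => ?_)
      ((summable_efkEig_pow_mul_exp hγ 1 hε).mul_right (4 * M))
    have hpos := efkEig_pos hγ k
    refine (MeasureTheory.integral_mono (hFi k).norm
      ((integrableOn_exp_neg_mul hpos).mul_const _) (hFb k)).trans (le_of_eq ?_)
    rw [MeasureTheory.integral_mul_const, integral_exp_neg_mul hpos]
    field_simp
  have hEq : ∑' k : ℕ, efkEig γ k * exp (-(efkEig γ k * ε)) * efkCoeffDeriv γ h k t *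
      sin ((k + 1) * π * x) = ∫ s in Ioi (0 : ℝ), ∑' k, F k s := by
    rw [← (MeasureTheory.hasSum_integral_of_summable_integral_norm hFi hsum).tsum_eq]
    congr 1
    funext k
    simp only [hF]
    rw [MeasureTheory.integral_mul_const, MeasureTheory.integral_const_mul]
    congr 2
    exact deriv_duhamel_eq_integral (efkEig_pos hγ k) (continuous_sineCoeff hc k)
      (fun s => hcoef s k) t
  obtain ⟨hI, hIv⟩ := integral_add_rpow hε hθ1
  have hbound : ∀ s ∈ Ioi (0 : ℝ), ‖∑' k, F k s‖ ≤ C * L * (s + ε) ^ (θ - 2) := fun s hs => by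
    have hs0 : (0 : ℝ) < s := hs
    have := hker (s + ε) (by positivity) (fun y => h t y - h (t - s) y)
      ((hct t).sub (hct _)) (L * s ^ θ) (fun y => by
        have := hH t (t - s) y
        rwa [sub_sub_cancel, abs_of_pos hs0] at this) x
    have e : ∀ k : ℕ, efkEig γ k ^ 2 * exp (-(efkEig γ k * (s + ε))) *
        sineCoeff (fun y => h t y - h (t - s) y) k * sin ((k + 1) * π * x) = F k s := fun k => by
      rw [sineCoeff_sub (hct t) (hct _), mul_add, neg_add, exp_add]
      ring
    simp_rw [e] at this
    refine this.trans ?_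
    have e2 : (s + ε) ^ (θ - 2) = (s + ε) ^ θ / (s + ε) ^ 2 := by
      rw [rpow_sub (by positivity)]
      norm_cast
    rw [e2, ← mul_assoc, ← mul_div_assoc]
    gcongr
    linarith
  rw [hEq, ← Real.norm_eq_abs]
  have h6 := MeasureTheory.norm_integral_le_of_norm_le
    (MeasureTheory.Integrable.const_mul hI (C * L))
    ((MeasureTheory.ae_restrict_iff' measurableSet_Ioi).2 (Eventually.of_forall hbound))
  rw [MeasureTheory.integral_const_mul, hIv] at h6
  exact h6.trans (le_of_eq (by ring))

end TimeDerivative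

/-- A family that is Cauchy as `ε → 0⁺` at a uniform power rate has a limit, at the same rate. -/
theorem exists_limit_of_rpow_cauchy {α : Type*} {q : ℝ → α → ℝ} {D θ : ℝ} (hθ : 0 < θ)
    (hq : ∀ p, ∀ a, 0 < a → ∀ b, a ≤ b → |q b p - q a p| ≤ D * b ^ θ) :
    ∃ v : α → ℝ, ∀ ε, 0 < ε → ∀ p, |q ε p - v p| ≤ D * ε ^ θ := by
  have hlim : Tendsto (fun n : ℕ => 1 / ((n : ℝ) + 1)) atTop (𝓝 0) :=
    tendsto_one_div_add_atTop_nhds_zero_nat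
  have hD : α → 0 ≤ D := fun p => by
    have := (abs_nonneg _).trans (hq p 1 one_pos 1 le_rfl)
    simpa using this
  have hex : ∀ p, ∃ v, Tendsto (fun n : ℕ => q (1 / ((n : ℝ) + 1)) p) atTop (𝓝 v) := fun p => by
    refine cauchySeq_tendsto_of_complete
      (cauchySeq_of_le_tendsto_0 (fun n : ℕ => D * (1 / ((n : ℝ) + 1)) ^ θ)
          (fun n m N hn hm => ?_) ?_)
    · have key : ∀ i j : ℕ, N ≤ i → i ≤ j →
          |q (1 / ((i : ℝ) + 1)) p - q (1 / ((j : ℝ) + 1)) p| ≤ D * (1 / ((N : ℝ) + 1)) ^ θ := by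
        intro i j hi hij
        refine (hq p _ (by positivity) _ (Nat.one_div_le_one_div hij)).trans ?_
        have := hD p
        have := Nat.one_div_le_one_div (α := ℝ) hi
        gcongr
      rw [Real.dist_eq]
      rcases le_total n m with h | h
      · exact key n m hn h
      · rw [abs_sub_comm]
        exact key m n hm h
    · have := (hlim.rpow_const (p := θ) (Or.inr hθ.le)).const_mul D
      simpa [zero_rpow hθ.ne'] using this
  choose v hv using hex
  refine ⟨v, fun ε hε p => ?_⟩
  refine le_of_tendsto ((tendsto_const_nhds.sub (hv p)).abs) ?_
  filter_upwards [hlim.eventually (ge_mem_nhds hε)] with n hn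
  exact hq p _ (by positivity) _ hn

section TimeDerivative

variable {γ : ℝ} {h : ℝ → ℝ → ℝ}

theorem abs_efkCoeffDeriv_le (hγ : 0 < γ) {C₀ : ℝ} (hC₀ : ∀ t k, |sineCoeff (h t) k| ≤ C₀) (k : ℕ)
    (t : ℝ) : |efkCoeffDeriv γ h k t| ≤ 2 * C₀ :=
  abs_deriv_duhamel_le (efkEig_pos hγ k) (fun s => hC₀ s k) t

theorem continuous_efkCoeffDeriv (hγ : 0 < γ) (hc : Continuous fun p : ℝ × ℝ => h p.1 p.2) {C₀ : ℝ}
    (hC₀ : ∀ t k, |sineCoeff (h t) k| ≤ C₀) (k : ℕ) : Continuous (efkCoeffDeriv γ h k) :=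
  (continuous_sineCoeff hc k).sub (continuous_const.mul (continuous_iff_continuousAt.2 fun t =>
    (hasDerivAt_efkCoeff hγ hc hC₀ k t).continuousAt))

/-- For a bounded continuous source, Hölder continuous in time, `efkSol` is `C¹` in time. -/
theorem exists_hasDerivAt_efkSol (hγ : 0 < γ)
    (hc : Continuous fun p : ℝ × ℝ => h p.1 p.2) {M : ℝ} (hM : ∀ t x, |h t x| ≤ M) {L θ : ℝ}
    (hL : 0 < L) (hθ : 0 < θ) (hθ1 : θ < 1)
    (hH : ∀ t s x, |h t x - h s x| ≤ L * |t - s| ^ θ) :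
    ∃ v : ℝ → ℝ → ℝ, (Continuous fun p : ℝ × ℝ => v p.1 p.2) ∧
      (∀ t x, HasDerivAt (fun s => efkSol γ h s x) (v t x) t) ∧
      ∀ t k, sineCoeff (v t) k = efkCoeffDeriv γ h k t := by
  obtain ⟨D, hD, hQ⟩ := exists_abs_tsum_efkEig_mul_efkCoeffDeriv_le hγ hc hM hL hθ hθ1 hH
  have hcoef : ∀ t k, |sineCoeff (h t) k| ≤ 2 * M := fun t => abs_sineCoeff_le fun y _ => hM t y
  have hb := abs_efkCoeffDeriv_le hγ hcoef
  have hbc := continuous_efkCoeffDeriv hγ hc hcoef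
  have hM0 : 0 ≤ M := (abs_nonneg _).trans (hM 0 0)
  set q : ℝ → ℝ × ℝ → ℝ := fun ε p => ∑' k : ℕ,
    exp (-(efkEig γ k * ε)) * efkCoeffDeriv γ h k p.1 * sin ((k + 1) * π * p.2) with hq
  have hsummable : ∀ (n : ℕ) {ε : ℝ}, 0 < ε →
      Summable fun k => efkEig γ k ^ n * exp (-(efkEig γ k * ε)) * (2 * (2 * M)) := fun n ε hε =>
    (summable_efkEig_pow_mul_exp hγ n hε).mul_right _
  have hterm : ∀ (k : ℕ) (ε t x : ℝ),
      ‖exp (-(efkEig γ k * ε)) * efkCoeffDeriv γ h k t * sin ((k + 1) * π * x)‖ ≤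
        efkEig γ k ^ 0 * exp (-(efkEig γ k * ε)) * (2 * (2 * M)) := fun k ε t x => by
    rw [norm_mul, norm_mul, Real.norm_eq_abs, abs_exp, pow_zero, one_mul]
    refine (mul_le_of_le_one_right (by positivity) (abs_sin_le_one _)).trans ?_
    exact mul_le_mul_of_nonneg_left (hb k t) (exp_pos _).le
  have hqderiv : ∀ p ε, 0 < ε → HasDerivAt (fun ε => q ε p)
      (∑' k : ℕ, -(efkEig γ k * exp (-(efkEig γ k * ε)) * efkCoeffDeriv γ h k p.1 *
        sin ((k + 1) * π * p.2))) ε := fun p ε hε => by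
    have hmem : ε ∈ Ioi (ε / 2) := half_lt_self hε
    refine hasDerivAt_tsum_of_isPreconnected (t := Ioi (ε / 2))
      (g := fun (k : ℕ) e => exp (-(efkEig γ k * e)) * efkCoeffDeriv γ h k p.1 *
        sin ((k + 1) * π * p.2))
      (g' := fun k e => -(efkEig γ k * exp (-(efkEig γ k * e)) * efkCoeffDeriv γ h k p.1 *
        sin ((k + 1) * π * p.2))) (y₀ := ε)
      (hsummable 1 (half_pos hε)) isOpen_Ioi isPreconnected_Ioi (fun k e _ => ?_)
      (fun k e he => ?_) hmem ?_ hmem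
    · have := ((((hasDerivAt_id e).const_mul (efkEig γ k)).neg.exp).mul_const
        (efkCoeffDeriv γ h k p.1)).mul_const (sin ((k + 1) * π * p.2))
      refine this.congr_deriv ?_
      simp only [Pi.neg_apply, id_eq, mul_one]
      ring
    · have hpos := efkEig_pos hγ k
      rw [norm_neg, norm_mul, norm_mul, norm_mul, Real.norm_eq_abs, Real.norm_eq_abs, abs_exp,
        abs_of_pos hpos, pow_one]
      refine (mul_le_of_le_one_right (by positivity) (abs_sin_le_one _)).trans ?_
      have e1 : exp (-(efkEig γ k * e)) ≤ exp (-(efkEig γ k * (ε / 2))) :=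
        exp_le_exp.2 (neg_le_neg (mul_le_mul_of_nonneg_left (le_of_lt he) hpos.le))
      have e2 := hb k p.1
      rw [← Real.norm_eq_abs] at e2
      gcongr
    · exact Summable.of_norm_bounded (hsummable 0 hε) fun k => hterm k ε p.1 p.2
  have hcauchy : ∀ p, ∀ a, 0 < a → ∀ b, a ≤ b → |q b p - q a p| ≤ D / θ * b ^ θ := by
    intro p a ha b hab
    have h1 := abs_sub_le_of_abs_deriv_le_deriv (B := fun ε => D / θ * ε ^ θ)
      (B' := fun ε => D * ε ^ (θ - 1)) hab
      (fun ε hε => hqderiv p ε (ha.trans_le hε.1)) (fun ε hε => by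
        have := (hasDerivAt_rpow_const (p := θ) (Or.inl (ha.trans_le hε.1).ne')).const_mul (D / θ)
        refine this.congr_deriv ?_
        field_simp) (fun ε hε => by
        rw [tsum_neg, abs_neg]
        exact hQ ε (ha.trans_le hε.1) p.1 p.2)
    have : 0 ≤ D / θ * a ^ θ := by positivity
    linarith
  obtain ⟨w, hw⟩ := exists_limit_of_rpow_cauchy hθ hcauchy
  have hrate : Tendsto (fun ε : ℝ => D / θ * ε ^ θ) (𝓝[>] 0) (𝓝 0) := by
    have := ((tendsto_id (α := ℝ) (x := 𝓝 0)).rpow_const (p := θ) (Or.inr hθ.le)).const_mul (D / θ)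
    simp only [id_eq, zero_rpow hθ.ne', mul_zero] at this
    exact this.mono_left nhdsWithin_le_nhds
  have hunif : TendstoUniformly q w (𝓝[>] 0) := by
    rw [Metric.tendstoUniformly_iff]
    intro e he
    filter_upwards [hrate.eventually (gt_mem_nhds he), self_mem_nhdsWithin] with ε hε hε0 p
    rw [dist_comm, Real.dist_eq]
    exact (hw ε hε0 p).trans_lt hε
  have hqc : ∀ ε, 0 < ε → Continuous (q ε) := fun ε hε =>
    continuous_tsum (fun k => by have := hbc k; fun_prop) (hsummable 0 hε) fun k p =>
      hterm k ε p.1 p.2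
  have hwc : Continuous w := hunif.continuous
    (Eventually.frequently (by filter_upwards [self_mem_nhdsWithin] with ε hε using hqc ε hε))
  refine ⟨fun t x => w (t, x), hwc, fun t x => ?_, fun t k => ?_⟩
  · refine hasDerivAt_of_tendstoUniformly (l := 𝓝[>] (0 : ℝ))
      (f := fun ε s => ∑' k : ℕ, exp (-(efkEig γ k * ε)) * efkCoeff γ h k s * sin ((k + 1) * π * x))
      (f' := fun ε s => q ε (s, x)) (g' := fun s => w (s, x)) (hunif.comp fun s => (s, x)) ?_
      (fun s => ?_) t
    · filter_upwards [self_mem_nhdsWithin] with ε hε s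
      refine hasDerivAt_tsum (y₀ := s) (hsummable 0 hε) (fun k r => ?_)
        (fun k r => hterm k ε r x) ?_ s
      · exact ((hasDerivAt_efkCoeff hγ hc hcoef k r).const_mul _).mul_const _
      · refine Summable.of_norm_bounded (summable_abs_efkCoeff hγ hcoef s) fun k => ?_
        rw [norm_mul, norm_mul, Real.norm_eq_abs, abs_exp]
        refine (mul_le_of_le_one_right (by positivity) (abs_sin_le_one _)).trans ?_
        refine mul_le_of_le_one_left (norm_nonneg _) (exp_le_one_iff.2 ?_)
        have := mul_pos (efkEig_pos hγ k) hε
        linarith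
    · refine tendsto_tsum_of_dominated_convergence (summable_abs_efkCoeff hγ hcoef s)
        (fun k => ?_) ?_
      · have : Continuous fun ε => exp (-(efkEig γ k * ε)) * efkCoeff γ h k s *
            sin ((k + 1) * π * x) := by fun_prop
        have := (this.tendsto 0).mono_left (nhdsWithin_le_nhds (s := Ioi 0))
        simpa using this
      · filter_upwards [self_mem_nhdsWithin] with ε hε k
        rw [norm_mul, norm_mul, Real.norm_eq_abs, abs_exp]
        refine (mul_le_of_le_one_right (by positivity) (abs_sin_le_one _)).trans ?_
        refine mul_le_of_le_one_left (norm_nonneg _) (exp_le_one_iff.2 ?_)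
        have := mul_pos (efkEig_pos hγ k) hε
        linarith
  · have hcw : Continuous fun x => w (t, x) := hwc.comp (Continuous.prodMk_right t)
    have hq1 : ∀ ε, 0 < ε → sineCoeff (fun x => q ε (t, x)) k =
        exp (-(efkEig γ k * ε)) * efkCoeffDeriv γ h k t := fun ε hε => by
      have habs : Summable fun k => |exp (-(efkEig γ k * ε)) * efkCoeffDeriv γ h k t| := by
        refine Summable.of_nonneg_of_le (fun _ => abs_nonneg _) (fun k => ?_) (hsummable 0 hε)
        rw [abs_mul, abs_exp, pow_zero, one_mul]
        exact mul_le_mul_of_nonneg_left (hb k t) (exp_pos _).le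
      have := intervalIntegral_tsum_mul_of_orthogonal (e := fun (k : ℕ) z => sin ((k + 1) * π * z))
        (fun k => by fun_prop) (fun k z => abs_sin_le_one _) integral_sin_mul_sin habs k
      unfold sineCoeff
      rw [this]
      ring
    have l1 : Tendsto (fun ε => sineCoeff (fun x => q ε (t, x)) k) (𝓝[>] 0)
        (𝓝 (sineCoeff (fun x => w (t, x)) k)) := by
      rw [tendsto_iff_dist_tendsto_zero]
      have h2 := hrate.const_mul 2
      rw [mul_zero] at h2
      refine squeeze_zero' (Eventually.of_forall fun _ => dist_nonneg) ?_ h2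
      filter_upwards [self_mem_nhdsWithin] with ε hε
      have hqt : Continuous fun x => q ε (t, x) := (hqc ε hε).comp (Continuous.prodMk_right t)
      rw [Real.dist_eq, ← sineCoeff_sub hqt hcw]
      exact abs_sineCoeff_le (fun y _ => hw ε hε (t, y)) k
    have l2 : Tendsto (fun ε => sineCoeff (fun x => q ε (t, x)) k) (𝓝[>] 0)
        (𝓝 (efkCoeffDeriv γ h k t)) := by
      have h3 : Continuous fun ε => exp (-(efkEig γ k * ε)) * efkCoeffDeriv γ h k t := by fun_prop
      have h4 := (h3.tendsto 0).mono_left (nhdsWithin_le_nhds (s := Ioi 0))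
      simp only [mul_zero, neg_zero, exp_zero, one_mul] at h4
      refine h4.congr' ?_
      filter_upwards [self_mem_nhdsWithin] with ε hε using (hq1 ε hε).symm
    exact tendsto_nhds_unique l1 l2

end TimeDerivative

theorem hasSum_cos_div_sq {z : ℝ} (hz : z ∈ Icc (0 : ℝ) 1) :
    HasSum (fun n : ℕ => cos (2 * π * (n + 1) * z) / (n + 1) ^ 2)
        (π ^ 2 * (z ^ 2 - z + 1 / 6)) := by
  have h := hasSum_one_div_nat_pow_mul_cos one_ne_zero hz
  rw [← hasSum_nat_add_iff' 1] at h
  have e := bernoulliFun_two z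
  rw [bernoulliFun] at e
  simp only [mul_one, e] at h
  have hv : π ^ 2 * (z ^ 2 - z + 1 / 6) = (-1) ^ (1 + 1) * (2 * π) ^ 2 / 2 / ↑(Nat.factorial 2) *
      (z ^ 2 - z + 6⁻¹) - ∑ x ∈ Finset.range 1, 1 / (x : ℝ) ^ 2 * cos (2 * π * x * z) := by
    rw [Finset.sum_range_one, Nat.cast_zero, zero_pow two_ne_zero, div_zero, zero_mul,
      Nat.factorial_two]
    push_cast
    ring
  rw [hv]
  refine h.congr_fun fun n => ?_
  push_cast
  rw [div_mul_eq_mul_div, one_mul]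

/-- The sine expansion of the Green function of `-d²/dx²` with Dirichlet conditions on `[0,1]`. -/
theorem hasSum_sin_mul_sin_div_sq {x y : ℝ} (hx : x ∈ Icc (0 : ℝ) 1) (hy : y ∈ Icc (0 : ℝ) 1) :
    HasSum (fun k : ℕ => 2 * (sin ((k + 1) * π * y) * (sin ((k + 1) * π * x) / ((k + 1) * π) ^ 2)))
      (min x y - x * y) := by
  obtain ⟨hx0, hx1⟩ := hx
  obtain ⟨hy0, hy1⟩ := hy
  have h1 := hasSum_cos_div_sq (z := |x - y| / 2) ⟨by positivity, by
    have : |x - y| ≤ 2 := abs_le.2 ⟨by linarith, by linarith⟩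
    linarith⟩
  have h2 := hasSum_cos_div_sq (z := (x + y) / 2) ⟨by linarith, by linarith⟩
  have hv : min x y - x * y = 1 / π ^ 2 * (π ^ 2 * ((|x - y| / 2) ^ 2 - |x - y| / 2 + 1 / 6) -
      π ^ 2 * (((x + y) / 2) ^ 2 - (x + y) / 2 + 1 / 6)) := by
    have : (|x - y| / 2) ^ 2 = (x - y) ^ 2 / 4 := by rw [div_pow, sq_abs]; ring
    rw [this]
    have hpi := pi_ne_zero
    rcases le_total x y with h | h
    · rw [min_eq_left h, abs_of_nonpos (sub_nonpos.2 h)]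
      field_simp
      ring
    · rw [min_eq_right h, abs_of_nonneg (sub_nonneg.2 h)]
      field_simp
      ring
  rw [hv]
  refine ((h1.sub h2).mul_left (1 / π ^ 2)).congr_fun fun k => ?_
  · have e1 : cos (2 * π * (k + 1) * (|x - y| / 2)) =
        cos ((k + 1) * π * x - (k + 1) * π * y) := by
      rcases abs_choice (x - y) with h | h <;> rw [h]
      · congr 1
        ring
      · rw [← cos_neg]
        congr 1
        ring
    have e2 : cos (2 * π * (k + 1) * ((x + y) / 2)) =
        cos ((k + 1) * π * x + (k + 1) * π * y) := by
      congr 1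
      ring
    rw [e1, e2, cos_sub, cos_add]
    field_simp
    ring

theorem hasSum_sineCoeff_div_sq {q : ℝ → ℝ} (hq : Continuous q) {x : ℝ} (hx : x ∈ Icc (0 : ℝ) 1) :
    HasSum (fun k : ℕ => sineCoeff q k * (sin ((k + 1) * π * x) / ((k + 1) * π) ^ 2))
      (x * (∫ y in (0 : ℝ)..1, (1 - y) * q y) - x * (∫ y in (0 : ℝ)..x, q y) +
        ∫ y in (0 : ℝ)..x, y * q y) := by
  obtain ⟨M, hM⟩ := isCompact_Icc.exists_bound_of_continuousOn (s := Icc (0 : ℝ) 1) hq.continuousOn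
  have hu : uIoc (0 : ℝ) 1 ⊆ Icc 0 1 := by
    rw [uIoc_of_le zero_le_one]
    exact Ioc_subset_Icc_self
  have hsum := intervalIntegral.hasSum_integral_of_dominated_convergence (a := 0) (b := 1)
    (μ := MeasureTheory.volume)
    (F := fun (k : ℕ) y => q y * (2 * (sin ((k + 1) * π * y) *
      (sin ((k + 1) * π * x) / ((k + 1) * π) ^ 2))))
    (f := fun y => q y * (min x y - x * y))
    (fun k _ => M * (2 * (1 / ((k : ℝ) + 1) ^ 2)))
    (fun k => Continuous.aestronglyMeasurable (by fun_prop))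
    (fun k => Eventually.of_forall fun y hy => ?_)
    (Eventually.of_forall fun y hy => (summable_one_div_succ_sq.mul_left 2).mul_left M)
    intervalIntegrable_const
    (Eventually.of_forall fun y hy => (hasSum_sin_mul_sin_div_sq hx (hu hy)).mul_left (q y))
  · have hv : x * (∫ y in (0 : ℝ)..1, (1 - y) * q y) - x * (∫ y in (0 : ℝ)..x, q y) +
        (∫ y in (0 : ℝ)..x, y * q y) = ∫ y in (0 : ℝ)..1, q y * (min x y - x * y) := by
      have hi : ∀ {p : ℝ → ℝ} (a b : ℝ), Continuous p →
          IntervalIntegrable p MeasureTheory.volume a b := fun a b hp => hp.intervalIntegrable a b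
      have c1 : Continuous fun y => (1 - y) * q y := by fun_prop
      have c2 : Continuous fun y => y * q y := by fun_prop
      have c3 : Continuous fun y => q y * (min x y - x * y) := by fun_prop
      rw [← intervalIntegral.integral_add_adjacent_intervals (hi 0 x c3) (hi x 1 c3),
        ← intervalIntegral.integral_add_adjacent_intervals (hi 0 x c1) (hi x 1 c1), mul_add]
      have e1 : ∫ y in (0 : ℝ)..x, q y * (min x y - x * y) =
          x * (∫ y in (0 : ℝ)..x, (1 - y) * q y) - x * (∫ y in (0 : ℝ)..x, q y) +
            ∫ y in (0 : ℝ)..x, y * q y := by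
        rw [← intervalIntegral.integral_const_mul, ← intervalIntegral.integral_const_mul,
          ← intervalIntegral.integral_sub (hi _ _ (by fun_prop)) (hi _ _ (by fun_prop)),
          ← intervalIntegral.integral_add (hi _ _ (by fun_prop)) (hi _ _ (by fun_prop))]
        refine intervalIntegral.integral_congr fun y hy => ?_
        rw [uIcc_of_le hx.1] at hy
        simp only [min_eq_right hy.2]
        ring
      have e2 : ∫ y in x..1, q y * (min x y - x * y) = x * ∫ y in x..1, (1 - y) * q y := by
        rw [← intervalIntegral.integral_const_mul]
        refine intervalIntegral.integral_congr fun y hy => ?_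
        rw [uIcc_of_le hx.2] at hy
        simp only [min_eq_left hy.1]
        ring
      rw [e1, e2]
      ring
    rw [hv]
    refine hsum.congr_fun fun k => ?_
    unfold sineCoeff
    rw [mul_assoc, mul_comm, ← intervalIntegral.integral_mul_const,
      ← intervalIntegral.integral_mul_const]
    congr 1
    ext y
    ring
  · have hqy := hM y (hu hy)
    have hM0 : 0 ≤ M := (norm_nonneg _).trans hqy
    have h1 : |sin ((k + 1) * π * y)| ≤ 1 := abs_sin_le_one _
    have h2 : |sin ((k + 1) * π * x) / ((k + 1) * π) ^ 2| ≤ 1 / ((k : ℝ) + 1) ^ 2 := by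
      rw [abs_div, abs_of_pos (by positivity : 0 < ((k + 1 : ℝ) * π) ^ 2)]
      refine div_le_div₀ zero_le_one (abs_sin_le_one _) (by positivity) ?_
      rw [mul_pow]
      have : 1 ≤ π ^ 2 := one_le_pow₀ (by linarith [pi_gt_three])
      exact le_mul_of_one_le_right (by positivity) this
    rw [norm_mul, Real.norm_eq_abs (2 * _), abs_mul, abs_mul, abs_two]
    refine mul_le_mul hqy ?_ (by positivity) hM0
    refine mul_le_mul_of_nonneg_left ?_ zero_le_two
    exact (mul_le_of_le_one_left (abs_nonneg _) h1).trans h2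

section SpaceDerivatives

variable {γ : ℝ} {h : ℝ → ℝ → ℝ}

theorem efkEig_eq (γ : ℝ) (k : ℕ) :
    efkEig γ k = γ * (((k + 1) * π) ^ 2) ^ 2 + ((k + 1) * π) ^ 2 - 1 := by
  unfold efkEig
  ring

theorem continuous_efkCoeff (hγ : 0 < γ) (hc : Continuous fun p : ℝ × ℝ => h p.1 p.2) {C₀ : ℝ}
    (hC₀ : ∀ t k, |sineCoeff (h t) k| ≤ C₀) (k : ℕ) : Continuous (efkCoeff γ h k) :=
  continuous_iff_continuousAt.2 fun t => (hasDerivAt_efkCoeff hγ hc hC₀ k t).continuousAt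

theorem sineCoeff_tsum {a : ℕ → ℝ} (ha : Summable fun k => |a k|) (j : ℕ) :
    sineCoeff (fun x => ∑' k : ℕ, a k * sin ((k + 1) * π * x)) j = a j := by
  unfold sineCoeff
  rw [intervalIntegral_tsum_mul_of_orthogonal (e := fun (k : ℕ) z => sin ((k + 1) * π * z))
    (fun k => by fun_prop) (fun k z => abs_sin_le_one _) integral_sin_mul_sin ha j]
  ring

/-- For a bounded continuous source, Hölder continuous in time, `efkSol` is a classical solution. -/
theorem efkSol_isClassical (hγ : 0 < γ)
    (hc : Continuous fun p : ℝ × ℝ => h p.1 p.2) {M : ℝ} (hM : ∀ t x, |h t x| ≤ M) {L θ : ℝ}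
    (hL : 0 < L) (hθ : 0 < θ) (hθ1 : θ < 1)
    (hH : ∀ t s x, |h t x - h s x| ≤ L * |t - s| ^ θ) :
    ∃ v u₁ u₂ u₃ u₄ : ℝ → ℝ → ℝ,
      (Continuous fun p : ℝ × ℝ => v p.1 p.2) ∧ (Continuous fun p : ℝ × ℝ => u₁ p.1 p.2) ∧
      (Continuous fun p : ℝ × ℝ => u₂ p.1 p.2) ∧ (Continuous fun p : ℝ × ℝ => u₃ p.1 p.2) ∧
      (Continuous fun p : ℝ × ℝ => u₄ p.1 p.2) ∧
      (∀ t x, HasDerivAt (fun s => efkSol γ h s x) (v t x) t) ∧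
      (∀ t x, HasDerivAt (efkSol γ h t) (u₁ t x) x) ∧ (∀ t x, HasDerivAt (u₁ t) (u₂ t x) x) ∧
      (∀ t, ∀ x ∈ Ioo (0 : ℝ) 1, HasDerivAt (u₂ t) (u₃ t x) x) ∧
      (∀ t x, HasDerivAt (u₃ t) (u₄ t x) x) ∧
      (∀ t x, v t x + γ * u₄ t x - u₂ t x - efkSol γ h t x = h t x) ∧
      ∀ t, efkSol γ h t 0 = 0 ∧ efkSol γ h t 1 = 0 ∧ u₂ t 0 = 0 ∧ u₂ t 1 = 0 := by
  obtain ⟨v, hvc, hv, hvcoef⟩ := exists_hasDerivAt_efkSol hγ hc hM hL hθ hθ1 hH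
  have hcoef : ∀ t k, |sineCoeff (h t) k| ≤ 2 * M := fun t => abs_sineCoeff_le fun y _ => hM t y
  have hu := abs_efkCoeff_le hγ hcoef
  have huc := continuous_efkCoeff hγ hc hcoef
  have hsolc := continuous_efkSol hγ hc hcoef
  have hM0 : 0 ≤ M := (abs_nonneg _).trans (hM 0 0)
  have hs2 : Summable fun k : ℕ => 2 * M * π ^ 2 * (((k : ℝ) + 1) ^ 2 / efkEig γ k) :=
    (summable_succ_sq_div_efkEig hγ).mul_left _
  have hs1 : Summable fun k : ℕ => 2 * M * π * (((k : ℝ) + 1) / efkEig γ k) :=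
    (summable_succ_div_efkEig hγ).mul_left _
  have hb1 : ∀ (k : ℕ) t, |efkCoeff γ h k t * ((k + 1) * π)| ≤
      2 * M * π * (((k : ℝ) + 1) / efkEig γ k) := fun k t => by
    rw [abs_mul, abs_of_pos (by positivity : 0 < ((k : ℝ) + 1) * π)]
    refine (mul_le_mul_of_nonneg_right (hu k t) (by positivity)).trans_eq ?_
    ring
  have hb2 : ∀ (k : ℕ) t, |-(efkCoeff γ h k t * ((k + 1) * π) ^ 2)| ≤
      2 * M * π ^ 2 * (((k : ℝ) + 1) ^ 2 / efkEig γ k) := fun k t => by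
    rw [abs_neg, abs_mul, abs_of_pos (by positivity : 0 < (((k : ℝ) + 1) * π) ^ 2)]
    refine (mul_le_mul_of_nonneg_right (hu k t) (by positivity)).trans_eq ?_
    ring
  have hb1' : ∀ (k : ℕ) t x, ‖efkCoeff γ h k t * ((k + 1) * π) * cos ((k + 1) * π * x)‖ ≤
      2 * M * π * (((k : ℝ) + 1) / efkEig γ k) := fun k t x => by
    rw [norm_mul]
    exact (mul_le_of_le_one_right (norm_nonneg _) (abs_cos_le_one _)).trans (hb1 k t)
  have hb2' : ∀ (k : ℕ) t x, ‖-(efkCoeff γ h k t * ((k + 1) * π) ^ 2) * sin ((k + 1) * π * x)‖ ≤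
      2 * M * π ^ 2 * (((k : ℝ) + 1) ^ 2 / efkEig γ k) := fun k t x => by
    rw [norm_mul]
    exact (mul_le_of_le_one_right (norm_nonneg _) (abs_sin_le_one _)).trans (hb2 k t)
  have hlin : ∀ (k : ℕ) (x : ℝ), HasDerivAt (fun x => ((k : ℝ) + 1) * π * x) ((k + 1) * π) x :=
    fun k x => by simpa using (hasDerivAt_id x).const_mul (((k : ℝ) + 1) * π)
  set u₁ : ℝ → ℝ → ℝ := fun t x =>
    ∑' k : ℕ, efkCoeff γ h k t * ((k + 1) * π) * cos ((k + 1) * π * x) with hu₁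
  set u₂ : ℝ → ℝ → ℝ := fun t x =>
    ∑' k : ℕ, -(efkCoeff γ h k t * ((k + 1) * π) ^ 2) * sin ((k + 1) * π * x) with hu₂
  have hd1 : ∀ t x, HasDerivAt (efkSol γ h t) (u₁ t x) x := fun t x => by
    refine hasDerivAt_tsum (y₀ := x) hs1 (fun k y => ?_) (fun k y => hb1' k t y)
      (summable_efkSol hγ hcoef t x) x
    refine ((hlin k y).sin.const_mul _).congr_deriv ?_
    ring
  have hd2 : ∀ t x, HasDerivAt (u₁ t) (u₂ t x) x := fun t x => by
    refine hasDerivAt_tsum (y₀ := x) hs2 (fun k y => ?_) (fun k y => hb2' k t y)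
      (Summable.of_norm_bounded hs1 fun k => hb1' k t x) x
    refine ((hlin k y).cos.const_mul _).congr_deriv ?_
    ring
  have hc1 : Continuous fun p : ℝ × ℝ => u₁ p.1 p.2 :=
    continuous_tsum (fun k => by have := huc k; fun_prop) hs1 fun k p => hb1' k p.1 p.2
  have hc2 : Continuous fun p : ℝ × ℝ => u₂ p.1 p.2 :=
    continuous_tsum (fun k => by have := huc k; fun_prop) hs2 fun k p => hb2' k p.1 p.2
  set Q : ℝ → ℝ → ℝ := fun t x => h t x - v t x + (efkSol γ h t x + u₂ t x) with hQ
  have hQc : Continuous fun p : ℝ × ℝ => Q p.1 p.2 := (hc.sub hvc).add (hsolc.add hc2)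
  have hQt : ∀ t, Continuous (Q t) := fun t => hQc.comp (Continuous.prodMk_right t)
  have hQcoef : ∀ t k, sineCoeff (Q t) k =
      γ * (efkCoeff γ h k t * (((k + 1) * π) ^ 2) ^ 2) := fun t k => by
    have c1 : Continuous fun x => h t x := hc.comp (Continuous.prodMk_right t)
    have c2 : Continuous fun x => v t x := hvc.comp (Continuous.prodMk_right t)
    have c3 : Continuous fun x => efkSol γ h t x := hsolc.comp (Continuous.prodMk_right t)
    have c4 : Continuous fun x => u₂ t x := hc2.comp (Continuous.prodMk_right t)
    have e1 : sineCoeff (fun x => efkSol γ h t x) k = efkCoeff γ h k t :=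
      sineCoeff_tsum (summable_abs_efkCoeff hγ hcoef t) k
    have e2 : sineCoeff (fun x => u₂ t x) k = -(efkCoeff γ h k t * ((k + 1) * π) ^ 2) :=
      sineCoeff_tsum (a := fun k : ℕ => -(efkCoeff γ h k t * ((k + 1) * π) ^ 2))
        (Summable.of_nonneg_of_le (fun _ => abs_nonneg _) (fun k => hb2 k t) hs2) k
    have e3 : sineCoeff (fun x => v t x) k = efkCoeffDeriv γ h k t := hvcoef t k
    have e4 : sineCoeff (fun x => h t x) k = sineCoeff (h t) k := rfl
    have c12 : Continuous fun x => h t x - v t x := c1.sub c2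
    have c34 : Continuous fun x => efkSol γ h t x + u₂ t x := c3.add c4
    rw [hQ]
    simp only
    rw [sineCoeff_add c12 c34, sineCoeff_sub c1 c2, sineCoeff_add c3 c4, e1, e2, e3,
      e4, efkCoeffDeriv, efkEig_eq]
    ring
  set c : ℝ → ℝ := fun t => ∫ y in (0 : ℝ)..1, (1 - y) * Q t y with hcdef
  have hcc : Continuous c :=
    intervalIntegral.continuous_parametric_intervalIntegral_of_continuous'
        (f := fun t y => (1 - y) * Q t y)
      (by simp only [Function.uncurry_def]; fun_prop) 0 1
  have hgreen : ∀ t, ∀ x ∈ Icc (0 : ℝ) 1, u₂ t x = -(1 / γ) *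
      (x * c t - x * (∫ y in (0 : ℝ)..x, Q t y) + ∫ y in (0 : ℝ)..x, y * Q t y) := fun t x hx => by
    have := (hasSum_sineCoeff_div_sq (hQt t) hx).mul_left (-(1 / γ))
    rw [← this.tsum_eq]
    refine tsum_congr fun k => ?_
    rw [hQcoef]
    field_simp
  have hInt : ∀ t x, HasDerivAt (fun x => ∫ y in (0 : ℝ)..x, Q t y) (Q t x) x := fun t x =>
    intervalIntegral.integral_hasDerivAt_right ((hQt t).intervalIntegrable _ _)
      ((hQt t).stronglyMeasurableAtFilter _ _) (hQt t).continuousAt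
  have hInt' : ∀ t x, HasDerivAt (fun x => ∫ y in (0 : ℝ)..x, y * Q t y) (x * Q t x) x :=
    fun t x => by
      have hc' : Continuous fun y => y * Q t y := continuous_id.mul (hQt t)
      exact intervalIntegral.integral_hasDerivAt_right (hc'.intervalIntegrable _ _)
        (hc'.stronglyMeasurableAtFilter _ _) hc'.continuousAt
  refine ⟨v, u₁, u₂, fun t x => -(1 / γ) * (c t - ∫ y in (0 : ℝ)..x, Q t y),
    fun t x => 1 / γ * Q t x, hvc, hc1, hc2, ?_, continuous_const.mul hQc, hv, hd1, hd2,
    fun t x hx => ?_, fun t x => ?_, fun t x => ?_, fun t => ⟨?_, ?_, ?_, ?_⟩⟩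
  · have := intervalIntegral.continuous_parametric_intervalIntegral_of_continuous
      (μ := MeasureTheory.volume) (f := fun (p : ℝ × ℝ) y => Q p.1 y) (a₀ := 0)
      (hQc.comp ((continuous_fst.comp continuous_fst).prodMk continuous_snd))
      (s := fun p => p.2) continuous_snd
    exact continuous_const.mul ((hcc.comp continuous_fst).sub this)
  · have := ((((hasDerivAt_id x).mul_const (c t)).sub
      ((hasDerivAt_id x).mul (hInt t x))).add (hInt' t x)).const_mul (-(1 / γ))
    refine (this.congr_deriv ?_).congr_of_eventuallyEq ?_
    · simp only [id_eq]
      ring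
    · filter_upwards [isOpen_Ioo.mem_nhds hx] with y hy
      exact hgreen t y (Ioo_subset_Icc_self hy)
  · refine (((hInt t x).const_sub (c t)).const_mul (-(1 / γ))).congr_deriv ?_
    ring
  · rw [hQ]
    field_simp
    ring
  · simp [efkSol]
  · simp only [efkSol, mul_one]
    simp_rw [← Nat.cast_succ, sin_nat_mul_pi]
    simp
  · simp [hu₂]
  · simp only [hu₂, mul_one]
    simp_rw [← Nat.cast_succ, sin_nat_mul_pi]
    simp

end SpaceDerivatives

/-- `efkSol` solves the delayed problem as soon as the source is consistent with the delays. -/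
theorem isPeriodicClassicalSolution_efkSol {γ ω : ℝ} (hγ : 0 < γ) {n : ℕ} {τ : Fin n → ℝ}
    {f : (Fin n → ℝ) → ℝ} {g h : ℝ → ℝ → ℝ} (hc : Continuous fun p : ℝ × ℝ => h p.1 p.2) {M : ℝ}
    (hM : ∀ t x, |h t x| ≤ M) {L θ : ℝ} (hL : 0 < L) (hθ : 0 < θ) (hθ1 : θ < 1)
    (hH : ∀ t s x, |h t x - h s x| ≤ L * |t - s| ^ θ) (hper : ∀ t, h (t + ω) = h t)
    (hfg : ∀ t, ∀ x ∈ Ioo (0 : ℝ) 1, h t x = g t x + f fun k => efkSol γ h (t - τ k) x) :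
    IsPeriodicClassicalSolution γ ω τ f g (efkSol γ h) := by
  obtain ⟨v, u₁, u₂, u₃, u₄, hvc, hc1, hc2, hc3, hc4, hv, h1, h2, h3, h4, heq, hbd⟩ :=
    efkSol_isClassical hγ hc hM hL hθ hθ1 hH
  have hcoef : ∀ t k, |sineCoeff (h t) k| ≤ 2 * M := fun t => abs_sineCoeff_le fun y _ => hM t y
  have hdt : ∀ t x, dt (efkSol γ h) t x = v t x := fun t x => (hv t x).deriv
  have d1 : ∀ t, iteratedDeriv 1 (efkSol γ h t) = u₁ t := fun t => by
    rw [iteratedDeriv_one]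
    exact funext fun x => (h1 t x).deriv
  have d2 : ∀ t, iteratedDeriv 2 (efkSol γ h t) = u₂ t := fun t => by
    rw [iteratedDeriv_succ, d1]
    exact funext fun x => (h2 t x).deriv
  have d3 : ∀ t, ∀ x ∈ Ioo (0 : ℝ) 1, iteratedDeriv 3 (efkSol γ h t) x = u₃ t x :=
    fun t x hx => by
      rw [iteratedDeriv_succ, d2]
      exact (h3 t x hx).deriv
  have h4' : ∀ t, ∀ x ∈ Ioo (0 : ℝ) 1,
      HasDerivAt (iteratedDeriv 3 (efkSol γ h t)) (u₄ t x) x := fun t x hx => by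
    refine (h4 t x).congr_of_eventuallyEq ?_
    filter_upwards [isOpen_Ioo.mem_nhds hx] with y hy using d3 t y hy
  have d4 : ∀ t, ∀ x ∈ Ioo (0 : ℝ) 1, iteratedDeriv 4 (efkSol γ h t) x = u₄ t x :=
    fun t x hx => by
      rw [iteratedDeriv_succ]
      exact (h4' t x hx).deriv
  have hsolc := continuous_efkSol hγ hc hcoef
  have hdx2 : ∀ t x, dx 2 (efkSol γ h) t x = u₂ t x := fun t x => congrFun (d2 t) x
  refine ⟨hsolc.continuousOn, efkSol_periodic hper, fun t x _ => (hv t x).differentiableAt,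
    fun t x hx k hk => ?_, ?_, fun k hk => ?_, ?_, fun t x hx => ?_, fun t => ?_⟩
  · interval_cases k
    · rw [iteratedDeriv_zero]
      exact (h1 t x).differentiableAt
    · rw [d1]
      exact (h2 t x).differentiableAt
    · rw [d2]
      exact (h3 t x hx).differentiableAt
    · exact (h4' t x hx).differentiableAt
  · simp_rw [hdt]
    exact hvc.continuousOn
  · have hmem : ∀ p : ℝ × ℝ, p ∈ (univ : Set ℝ) ×ˢ Ioo (0 : ℝ) 1 → p.2 ∈ Ioo (0 : ℝ) 1 :=
      fun p hp => hp.2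
    interval_cases k
    · simpa only [dx, iteratedDeriv_zero] using hsolc.continuousOn
    · simpa only [dx, d1] using hc1.continuousOn
    · simpa only [dx, d2] using hc2.continuousOn
    · exact hc3.continuousOn.congr fun p hp => d3 p.1 p.2 (hmem p hp)
    · exact hc4.continuousOn.congr fun p hp => d4 p.1 p.2 (hmem p hp)
  · simp_rw [hdx2]
    exact hc2.continuousOn
  · rw [hdt, hdx2, ← hfg t x hx, ← heq t x]
    unfold dx
    rw [d4 t x hx]
  · rw [hdx2, hdx2]
    exact hbd t

theorem ContinuousMap.isCompact_of_abs_le_of_equicontinuous {Y : Type*} [TopologicalSpace Y]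
    [CompactSpace Y] {S : Set C(Y, ℝ)} {C : ℝ} (hS : IsClosed S) (hC : ∀ U ∈ S, ∀ y, |U y| ≤ C)
    (heq : ∀ y₀, ∀ ε > 0, ∀ᶠ y in 𝓝 y₀, ∀ U ∈ S, |U y₀ - U y| < ε) : IsCompact S := by
  let e := ContinuousMap.isometryEquivBoundedOfCompact Y ℝ
  rw [← e.toHomeomorph.isCompact_image]
  refine BoundedContinuousFunction.arzela_ascoli₂ (Icc (-C) C) isCompact_Icc _
    (e.toHomeomorph.isClosed_image.2 hS) ?_ fun y₀ => ?_
  · rintro _ y ⟨U, hU, rfl⟩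
    exact abs_le.1 (hC U hU y)
  · rw [Metric.equicontinuousAt_iff_right]
    intro ε hε
    filter_upwards [heq y₀ ε hε] with y hy
    rintro ⟨_, U, hU, rfl⟩
    exact hy U hU

section PeriodicLift

variable {ω : ℝ}

theorem isOpenQuotientMap_coe_prod_id :
    IsOpenQuotientMap (Prod.map ((↑) : ℝ → AddCircle ω) (id : unitInterval → unitInterval)) :=
  QuotientAddGroup.isOpenQuotientMap_mk.prodMap IsOpenQuotientMap.id

theorem exists_continuousMap_of_periodic {u : ℝ → ℝ → ℝ}
    (hc : Continuous fun p : ℝ × ℝ => u p.1 p.2)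
    (hper : ∀ t x, u (t + ω) x = u t x) :
    ∃ U : C(AddCircle ω × unitInterval, ℝ), ∀ (t : ℝ) (x : unitInterval), U (t, x) = u t x := by
  have hp : ∀ x, Function.Periodic (fun t => u t x) ω := fun x t => hper t x
  refine ⟨⟨fun p => (hp p.2).lift p.1, ?_⟩, fun t x => (hp x).lift_coe t⟩
  rw [← isOpenQuotientMap_coe_prod_id.continuous_comp_iff]
  have : Continuous fun p : ℝ × unitInterval => u p.1 p.2 :=
    hc.comp (continuous_fst.prodMk (continuous_subtype_val.comp continuous_snd))
  exact this.congr fun p => ((hp p.2).lift_coe p.1).symm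

/-- The extension to `ℝ × ℝ` of a function on `AddCircle ω × [0,1]`: periodic in the first variable,
constant outside `[0,1]` in the second one. -/
noncomputable def stripExtend (U : C(AddCircle ω × unitInterval, ℝ)) (t x : ℝ) : ℝ :=
  U (t, projIcc 0 1 zero_le_one x)

theorem continuous_stripExtend (U : C(AddCircle ω × unitInterval, ℝ)) :
    Continuous fun p : ℝ × ℝ => stripExtend U p.1 p.2 :=
  U.continuous.comp ((continuous_quotient_mk'.comp continuous_fst).prodMk
    (continuous_projIcc.comp continuous_snd))

theorem stripExtend_add_period (U : C(AddCircle ω × unitInterval, ℝ)) (t x : ℝ) :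
    stripExtend U (t + ω) x = stripExtend U t x := by
  rw [stripExtend, AddCircle.coe_add_period, stripExtend]

theorem abs_stripExtend_sub_le [Fact (0 < ω)] (U V : C(AddCircle ω × unitInterval, ℝ)) (t x : ℝ) :
    |stripExtend U t x - stripExtend V t x| ≤ dist U V := by
  rw [← Real.dist_eq]
  exact ContinuousMap.dist_apply_le_dist _

theorem continuous_integral_stripExtend_sq (t : ℝ) :
    Continuous fun U : C(AddCircle ω × unitInterval, ℝ) =>
      ∫ y in (0 : ℝ)..1, stripExtend U t y ^ 2 := by
  refine intervalIntegral.continuous_parametric_intervalIntegral_of_continuous'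
    (f := fun (U : C(AddCircle ω × unitInterval, ℝ)) y => stripExtend U t y ^ 2) ?_ 0 1
  have : Continuous fun p : C(AddCircle ω × unitInterval, ℝ) × ℝ =>
      p.1 ((t : AddCircle ω), projIcc (0 : ℝ) 1 zero_le_one p.2) :=
    ContinuousEval.continuous_eval.comp
      (continuous_fst.prodMk (continuous_const.prodMk (continuous_projIcc.comp continuous_snd)))
  exact this.pow 2

variable (ω) in
/-- The invariant set for the fixed point argument. -/
def stripBall (R C C' : ℝ) : Set C(AddCircle ω × unitInterval, ℝ) :=
  {U | (∀ t : ℝ, ∫ y in (0 : ℝ)..1, stripExtend U t y ^ 2 ≤ R) ∧ (∀ y, |U y| ≤ C) ∧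
    ∀ (t t' : ℝ) (x x' : unitInterval), |U (t, x) - U (t', x')| ≤ C' * (√|t - t'| + |(x : ℝ) - x'|)}

theorem isCompact_stripBall [Fact (0 < ω)] (R C C' : ℝ) : IsCompact (stripBall ω R C C') := by
  refine ContinuousMap.isCompact_of_abs_le_of_equicontinuous (C := C) ?_ (fun U hU => hU.2.1) ?_
  · have : stripBall ω R C C' =
      {U | ∀ t : ℝ, ∫ y in (0 : ℝ)..1, stripExtend U t y ^ 2 ≤ R} ∩ ({U | ∀ y, |U y| ≤ C} ∩
        {U | ∀ (t t' : ℝ) (x x' : unitInterval),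
          |U (t, x) - U (t', x')| ≤ C' * (√|t - t'| + |(x : ℝ) - x'|)}) := rfl
    rw [this]
    simp only [ofPred_forall]
    refine (isClosed_iInter fun t => isClosed_le (continuous_integral_stripExtend_sq t)
      continuous_const).inter ((isClosed_iInter fun y => isClosed_le
        (continuous_eval_const y).abs continuous_const).inter ?_)
    exact isClosed_iInter fun t => isClosed_iInter fun t' => isClosed_iInter fun x =>
      isClosed_iInter fun x' => isClosed_le
        ((continuous_eval_const _).sub (continuous_eval_const _)).abs continuous_const
  · rintro y₀ ε hε
    obtain ⟨⟨t₀, x₀⟩, rfl⟩ := (isOpenQuotientMap_coe_prod_id (ω := ω)).surjective y₀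
    rw [← isOpenQuotientMap_coe_prod_id.map_nhds_eq, eventually_map]
    have hcont : Continuous fun p : ℝ × unitInterval =>
        C' * (√|t₀ - p.1| + |(x₀ : ℝ) - p.2|) := by fun_prop
    have := hcont.tendsto (t₀, x₀)
    simp only [sub_self, abs_zero, sqrt_zero, add_zero, mul_zero] at this
    filter_upwards [this.eventually (gt_mem_nhds hε)] with p hp U hU
    exact (hU.2.2 t₀ p.1 x₀ p.2).trans_lt hp

theorem convex_stripBall (R C C' : ℝ) : Convex ℝ (stripBall ω R C C') := by
  rintro U ⟨hU1, hU2, hU3⟩ V ⟨hV1, hV2, hV3⟩ a b ha hb hab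
  have habs : ∀ {p q c : ℝ}, |p| ≤ c → |q| ≤ c → |a * p + b * q| ≤ c := fun {p q c} hp hq => by
    refine (abs_add_le _ _).trans ?_
    rw [abs_mul, abs_mul, abs_of_nonneg ha, abs_of_nonneg hb]
    have := mul_le_mul_of_nonneg_left hp ha
    have := mul_le_mul_of_nonneg_left hq hb
    have : c = a * c + b * c := by rw [← add_mul, hab, one_mul]
    linarith
  refine ⟨fun t => ?_, fun y => habs (hU2 y) (hV2 y), fun t t' x x' => ?_⟩
  · have hc : ∀ W : C(AddCircle ω × unitInterval, ℝ), Continuous fun y => stripExtend W t y :=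
      fun W => (continuous_stripExtend W).comp (Continuous.prodMk_right t)
    have hUc := hc U
    have hVc := hc V
    have e : ∀ y, stripExtend (a • U + b • V) t y = a * stripExtend U t y + b * stripExtend V t y :=
      fun y => rfl
    simp_rw [e]
    calc ∫ y in (0 : ℝ)..1, (a * stripExtend U t y + b * stripExtend V t y) ^ 2
        ≤ ∫ y in (0 : ℝ)..1, (a * stripExtend U t y ^ 2 + b * stripExtend V t y ^ 2) := by
          refine intervalIntegral.integral_mono_on zero_le_one
            (Continuous.intervalIntegrable (by fun_prop) _ _)
            (Continuous.intervalIntegrable (by fun_prop) _ _) fun y _ => ?_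
          obtain rfl : b = 1 - a := by linarith
          nlinarith [mul_nonneg (mul_nonneg ha hb)
            (sq_nonneg (stripExtend U t y - stripExtend V t y))]
      _ = a * (∫ y in (0 : ℝ)..1, stripExtend U t y ^ 2) +
            b * ∫ y in (0 : ℝ)..1, stripExtend V t y ^ 2 := by
          rw [intervalIntegral.integral_add (Continuous.intervalIntegrable (by fun_prop) _ _)
            (Continuous.intervalIntegrable (by fun_prop) _ _), intervalIntegral.integral_const_mul,
            intervalIntegral.integral_const_mul]
      _ ≤ a * R + b * R := by
          gcongr
          · exact hU1 t
          · exact hV1 t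
      _ = R := by rw [← add_mul, hab, one_mul]
  · have e : (a • U + b • V) (t, x) - (a • U + b • V) (t', x') =
        a * (U (t, x) - U (t', x')) + b * (V (t, x) - V (t', x')) := by
      change a * U (t, x) + b * V (t, x) - (a * U (t', x') + b * V (t', x')) = _
      ring
    rw [e]
    exact habs (hU3 t t' x x') (hV3 t t' x x')

end PeriodicLift

/-- Weighted Cauchy–Schwarz inequality for an affine bound. -/
theorem sq_sum_mul_abs_add_le {n : ℕ} {β : Fin n → ℝ} (hβ : ∀ k, 0 < β k) (hB : 0 < ∑ k, β k)
    {K κ : ℝ} (hκ : 0 < κ) (ξ : Fin n → ℝ) :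
    (∑ k, β k * |ξ k| + K) ^ 2 ≤ (∑ k, β k + κ) * (∑ k, β k * ξ k ^ 2 + κ * (K / κ) ^ 2) := by
  have h := Finset.sum_sq_le_sum_mul_sum_of_sq_le_mul Finset.univ (r := fun k => β k * |ξ k|)
      (f := β)
    (g := fun k => β k * ξ k ^ 2) (fun k _ => (hβ k).le)
    (fun k _ => mul_nonneg (hβ k).le (sq_nonneg _)) fun k _ => by
      rw [mul_pow, sq_abs]
      exact le_of_eq (by ring)
  set a := ∑ k, β k * |ξ k|
  set s := ∑ k, β k * ξ k ^ 2
  set B := ∑ k, β k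
  have h1 : 0 ≤ B * (B * (K / κ) ^ 2 + s - 2 * a * (K / κ)) := by
    nlinarith [sq_nonneg (B * (K / κ) - a)]
  have h2 : 0 ≤ B * (K / κ) ^ 2 + s - 2 * a * (K / κ) := nonneg_of_mul_nonneg_right h1 hB
  obtain ⟨r, rfl⟩ : ∃ r, K = κ * r := ⟨K / κ, by field_simp⟩
  rw [mul_div_cancel_left₀ _ hκ.ne'] at h2 ⊢
  nlinarith [mul_nonneg hκ.le h2]

section DelaySource

variable {ω : ℝ} {n : ℕ} {τ : Fin n → ℝ} {f : (Fin n → ℝ) → ℝ} {g : ℝ → ℝ → ℝ}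

/-- The right-hand side `g(t,x) + f(U(t-τ₁,x), …, U(t-τₙ,x))`, extended to `ℝ × ℝ`. -/
noncomputable def delaySource (τ : Fin n → ℝ) (f : (Fin n → ℝ) → ℝ) (g : ℝ → ℝ → ℝ)
    (U : C(AddCircle ω × unitInterval, ℝ)) (t x : ℝ) : ℝ :=
  g t (projIcc (0 : ℝ) 1 zero_le_one x) + f fun k => stripExtend U (t - τ k) x

theorem continuous_projIcc_of_hoelder {L θ : ℝ} (hθ : 0 < θ)
    (hg : ∀ t : ℝ, ∀ x ∈ Icc (0 : ℝ) 1, ∀ s : ℝ, ∀ y ∈ Icc (0 : ℝ) 1,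
      |g t x - g s y| ≤ L * (|t - s| + |x - y|) ^ θ) :
    Continuous fun p : ℝ × ℝ => g p.1 (projIcc (0 : ℝ) 1 zero_le_one p.2) := by
  rw [continuous_iff_continuousAt]
  intro p
  rw [ContinuousAt, tendsto_iff_dist_tendsto_zero]
  have hc : Continuous fun q : ℝ × ℝ => L * (|q.1 - p.1| +
      |(projIcc (0 : ℝ) 1 zero_le_one q.2 : ℝ) - projIcc (0 : ℝ) 1 zero_le_one p.2|) ^ θ := by
    refine continuous_const.mul (Continuous.rpow_const ?_ fun _ => Or.inr hθ.le)
    have : Continuous fun q : ℝ × ℝ => (projIcc (0 : ℝ) 1 zero_le_one q.2 : ℝ) :=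
      continuous_subtype_val.comp (continuous_projIcc.comp continuous_snd)
    fun_prop
  have h0 := hc.tendsto p
  simp only [sub_self, abs_zero, add_zero, zero_rpow hθ.ne', mul_zero] at h0
  exact squeeze_zero (fun _ => dist_nonneg)
    (fun q => hg q.1 _ (projIcc _ _ _ q.2).2 p.1 _ (projIcc _ _ _ p.2).2) h0

theorem continuous_delaySource (hf : Continuous f)
    (hg : Continuous fun p : ℝ × ℝ => g p.1 (projIcc (0 : ℝ) 1 zero_le_one p.2))
    (U : C(AddCircle ω × unitInterval, ℝ)) :
    Continuous fun p : ℝ × ℝ => delaySource τ f g U p.1 p.2 := by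
  refine hg.add (hf.comp (continuous_pi fun k => ?_))
  exact (continuous_stripExtend U).comp
    ((continuous_fst.sub continuous_const).prodMk continuous_snd)

theorem delaySource_add_period (hg : ∀ t : ℝ, ∀ x ∈ Icc (0 : ℝ) 1, g (t + ω) x = g t x)
    (U : C(AddCircle ω × unitInterval, ℝ)) (t : ℝ) :
    delaySource τ f g U (t + ω) = delaySource τ f g U t := by
  funext x
  simp only [delaySource, add_sub_right_comm, stripExtend_add_period,
    hg t _ (projIcc (0 : ℝ) 1 zero_le_one x).2]

theorem integral_delaySource_sq_le {β : Fin n → ℝ} {K : ℝ} (hf : Continuous f)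
    (hg : Continuous fun p : ℝ × ℝ => g p.1 (projIcc (0 : ℝ) 1 zero_le_one p.2))
    (hβ : ∀ k, 0 < β k) (hB : 0 < ∑ k, β k)
    (hH1 : ∀ t : ℝ, ∀ x ∈ Icc (0 : ℝ) 1, ∀ ξ : Fin n → ℝ, |f ξ + g t x| ≤ ∑ k, β k * |ξ k| + K)
    {l : ℝ} (hl : ∑ k, β k < l) {U : C(AddCircle ω × unitInterval, ℝ)}
    (hU : ∀ t : ℝ, ∫ y in (0 : ℝ)..1, stripExtend U t y ^ 2 ≤ (K / (l - ∑ k, β k)) ^ 2) (t : ℝ) :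
    ∫ y in (0 : ℝ)..1, delaySource τ f g U t y ^ 2 ≤ l ^ 2 * (K / (l - ∑ k, β k)) ^ 2 := by
  have hκ : 0 < l - ∑ k, β k := sub_pos.2 hl
  set κ := l - ∑ k, β k with hκdef
  have hlB : ∑ k, β k + κ = l := by rw [hκdef]; ring
  have hl0 : 0 < l := hB.trans hl
  have hUc : ∀ k, Continuous fun y => stripExtend U (t - τ k) y := fun k =>
    (continuous_stripExtend U).comp (Continuous.prodMk_right _)
  have hc : Continuous fun y => delaySource τ f g U t y :=
    (continuous_delaySource hf hg U).comp (Continuous.prodMk_right t)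
  have hi : ∀ k ∈ Finset.univ, IntervalIntegrable (fun y => β k * stripExtend U (t - τ k) y ^ 2)
      MeasureTheory.volume 0 1 := fun k _ => by
    have := hUc k
    exact Continuous.intervalIntegrable (by fun_prop) _ _
  have hc' : Continuous fun y => ∑ k, β k * stripExtend U (t - τ k) y ^ 2 := by fun_prop
  calc ∫ y in (0 : ℝ)..1, delaySource τ f g U t y ^ 2
      ≤ ∫ y in (0 : ℝ)..1, l * (∑ k, β k * stripExtend U (t - τ k) y ^ 2 + κ * (K / κ) ^ 2) := by
        refine intervalIntegral.integral_mono_on zero_le_one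
          (Continuous.intervalIntegrable (by fun_prop) _ _)
          (Continuous.intervalIntegrable (by fun_prop) _ _) fun y _ => ?_
        have h1 := hH1 t _ (projIcc (0 : ℝ) 1 zero_le_one y).2 fun k => stripExtend U (t - τ k) y
        rw [add_comm] at h1
        have h2 := sq_sum_mul_abs_add_le hβ hB (K := K) hκ fun k => stripExtend U (t - τ k) y
        rw [hlB] at h2
        refine le_trans ?_ h2
        rw [← sq_abs]
        exact pow_le_pow_left₀ (abs_nonneg _) h1 2
    _ = l * (∑ k, β k * (∫ y in (0 : ℝ)..1, stripExtend U (t - τ k) y ^ 2) + κ * (K / κ) ^ 2) := by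
        rw [intervalIntegral.integral_const_mul,
          intervalIntegral.integral_add (hc'.intervalIntegrable _ _) intervalIntegrable_const,
          intervalIntegral.integral_finsetSum hi, intervalIntegral.integral_const]
        simp_rw [intervalIntegral.integral_const_mul]
        simp
    _ ≤ l * (∑ k, β k * (K / κ) ^ 2 + κ * (K / κ) ^ 2) := by
        gcongr with k
        · exact (hβ k).le
        · exact hU _
    _ = l ^ 2 * (K / κ) ^ 2 := by
        rw [← Finset.sum_mul, ← add_mul, hlB]
        ring

theorem abs_delaySource_sub_le [Fact (0 < ω)] {C : ℝ} {Lf : NNReal}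
    (hf : LipschitzOnWith Lf f (Metric.closedBall 0 C)) {U V : C(AddCircle ω × unitInterval, ℝ)}
    (hU : ∀ y, |U y| ≤ C) (hV : ∀ y, |V y| ≤ C) (t x : ℝ) :
    |delaySource τ f g U t x - delaySource τ f g V t x| ≤ Lf * dist U V := by
  have hC : 0 ≤ C := (abs_nonneg _).trans (hU (((0 : ℝ) : AddCircle ω), 0))
  have hmem : ∀ W : C(AddCircle ω × unitInterval, ℝ), (∀ y, |W y| ≤ C) →
      (fun k => stripExtend W (t - τ k) x) ∈ Metric.closedBall (0 : Fin n → ℝ) C := fun W hW => by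
    rw [mem_closedBall_zero_iff, pi_norm_le_iff_of_nonneg hC]
    exact fun k => hW _
  have h := hf.dist_le_mul _ (hmem U hU) _ (hmem V hV)
  rw [Real.dist_eq] at h
  unfold delaySource
  rw [add_sub_add_left_eq_sub]
  refine h.trans (mul_le_mul_of_nonneg_left ?_ Lf.2)
  rw [dist_pi_le_iff dist_nonneg]
  exact fun k => abs_stripExtend_sub_le U V _ _

theorem exists_hoelder_delaySource {L θ : ℝ} (hL : 0 < L) (hθ : 0 < θ)
    (hg : ∀ t : ℝ, ∀ x ∈ Icc (0 : ℝ) 1, ∀ s : ℝ, ∀ y ∈ Icc (0 : ℝ) 1,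
      |g t x - g s y| ≤ L * (|t - s| + |x - y|) ^ θ) {R C C' : ℝ} {Lf : NNReal} (hC' : 0 ≤ C')
    (hf : LipschitzOnWith Lf f (Metric.closedBall 0 C)) {U : C(AddCircle ω × unitInterval, ℝ)}
    (hU : U ∈ stripBall ω R C C') {M : ℝ} (hM : ∀ t x, |delaySource τ f g U t x| ≤ M) :
    ∃ L' > (0 : ℝ), ∃ θ' : ℝ, 0 < θ' ∧ θ' < 1 ∧
      ∀ t s x, |delaySource τ f g U t x - delaySource τ f g U s x| ≤ L' * |t - s| ^ θ' := by
  obtain ⟨-, hUC, hUH⟩ := hU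
  have hC : 0 ≤ C := (abs_nonneg _).trans (hUC (((0 : ℝ) : AddCircle ω), 0))
  have hM0 : 0 ≤ M := (abs_nonneg _).trans (hM 0 0)
  obtain ⟨m, hmin, hmθ, hm2⟩ : ∃ m : ℝ, 0 < m ∧ m ≤ θ ∧ m ≤ 1 / 2 :=
    ⟨min θ (1 / 2), lt_min hθ one_half_pos, min_le_left _ _, min_le_right _ _⟩
  refine ⟨L + Lf * C' + 2 * M, by positivity, m, hmin,
    hm2.trans_lt one_half_lt_one, fun t s x => ?_⟩
  rcases le_or_gt |t - s| 1 with h1 | h1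
  · have hmem : ∀ t, (fun k => stripExtend U (t - τ k) x) ∈ Metric.closedBall (0 : Fin n → ℝ) C :=
      fun t => by
        rw [mem_closedBall_zero_iff, pi_norm_le_iff_of_nonneg hC]
        exact fun k => hUC _
    have hle : ∀ r : ℝ, m ≤ r → |t - s| ^ r ≤ |t - s| ^ m := fun r hr => by
      rcases (abs_nonneg (t - s)).eq_or_lt with h0 | h0
      · rw [← h0, zero_rpow hmin.ne', zero_rpow (hmin.trans_le hr).ne']
      · exact rpow_le_rpow_of_exponent_ge h0 h1 hr
    have e1 := hg t _ (projIcc (0 : ℝ) 1 zero_le_one x).2 s _ (projIcc (0 : ℝ) 1 zero_le_one x).2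
    rw [sub_self, abs_zero, add_zero] at e1
    have e2 := hf.dist_le_mul _ (hmem t) _ (hmem s)
    rw [Real.dist_eq] at e2
    have e3 : dist (fun k => stripExtend U (t - τ k) x) (fun k => stripExtend U (s - τ k) x) ≤
        C' * √|t - s| := by
      rw [dist_pi_le_iff (by positivity)]
      intro k
      have := hUH (t - τ k) (s - τ k) (projIcc (0 : ℝ) 1 zero_le_one x)
        (projIcc (0 : ℝ) 1 zero_le_one x)
      rw [sub_self, abs_zero, add_zero, sub_sub_sub_cancel_right] at this
      exact this
    rw [sqrt_eq_rpow] at e3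
    have e4 := hle θ hmθ
    have e5 := hle (1 / 2) hm2
    unfold delaySource
    rw [add_sub_add_comm]
    refine (abs_add_le _ _).trans ?_
    calc _ ≤ L * |t - s| ^ m + Lf * (C' * |t - s| ^ m) := by
          refine add_le_add (e1.trans (by gcongr)) (e2.trans ?_)
          gcongr
          exact e3.trans (by gcongr)
      _ = (L + Lf * C') * |t - s| ^ m := by ring
      _ ≤ _ := by
          exact mul_le_mul_of_nonneg_right (le_add_of_nonneg_right (by positivity)) (by positivity)
  · have e1 : 1 ≤ |t - s| ^ m := one_le_rpow h1.le hmin.le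
    have e2 : |delaySource τ f g U t x - delaySource τ f g U s x| ≤ 2 * M := by
      refine (abs_sub _ _).trans ?_
      linarith [hM t x, hM s x]
    refine e2.trans ?_
    calc 2 * M ≤ L + Lf * C' + 2 * M := le_add_of_nonneg_left (by positivity)
      _ ≤ _ := le_mul_of_one_le_right (by positivity) e1

end DelaySource

/-- **Schauder's fixed point theorem** in the space of continuous functions on a compact space. -/
theorem ContinuousMap.exists_fixedPoint_of_isCompact_of_convex {Y : Type*} [TopologicalSpace Y]
    [CompactSpace Y] {S : Set C(Y, ℝ)} (hS : IsCompact S) (hconv : Convex ℝ S) (hne : S.Nonempty)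
    {Φ : C(Y, ℝ) → C(Y, ℝ)} (hΦ : ContinuousOn Φ S) (hmaps : MapsTo Φ S S) : ∃ U ∈ S, Φ U = U :=
  _root_.exists_fixedPoint_of_isCompact_of_convex hS hconv hne hΦ hmaps

/-- Existence of a fixed point of the solution operator composed with the delayed source, by
Schauder's theorem on a set that is bounded in `L²`, bounded uniformly, and equi-Hölder. -/
theorem exists_stripExtend_eq_efkSol {γ ω : ℝ} (hγ : 0 < γ) (hω : 0 < ω) {n : ℕ}
    {τ : Fin n → ℝ} {f : (Fin n → ℝ) → ℝ} (hf : LocallyLipschitz f) {g : ℝ → ℝ → ℝ}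
    (hgc : Continuous fun p : ℝ × ℝ => g p.1 (projIcc (0 : ℝ) 1 zero_le_one p.2))
    (hgper : ∀ t : ℝ, ∀ x ∈ Icc (0 : ℝ) 1, g (t + ω) x = g t x)
    {β : Fin n → ℝ} (hβ : ∀ k, 0 < β k) (hB : 0 < ∑ k, β k) {K : ℝ}
    (hH1 : ∀ t : ℝ, ∀ x ∈ Icc (0 : ℝ) 1, ∀ ξ : Fin n → ℝ, |f ξ + g t x| ≤ ∑ k, β k * |ξ k| + K)
    (hl : ∑ k, β k < efkEig γ 0) :
    ∃ R C C' : ℝ, 0 ≤ C' ∧ ∃ U ∈ stripBall ω R C C', ∀ t, ∀ x ∈ Icc (0 : ℝ) 1,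
      stripExtend U t x = efkSol γ (delaySource τ f g U) t x := by
  have : Fact (0 < ω) := ⟨hω⟩
  have hfc := hf.continuous
  set R := (K / (efkEig γ 0 - ∑ k, β k)) ^ 2
  have hR0 : 0 ≤ R := sq_nonneg _
  set C₀ := 2 * (efkEig γ 0 ^ 2 * R) + 1
  have hC₀0 : 0 ≤ C₀ := by positivity
  set T := ∑' k, 1 / efkEig γ k
  have hT : 0 ≤ T := tsum_nonneg fun k => (one_div_pos.2 (efkEig_pos hγ k)).le
  set C := C₀ * T
  have hC0 : 0 ≤ C := mul_nonneg hC₀0 hT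
  obtain ⟨Cc, hCc, hHolder⟩ := exists_abs_efkSol_sub_le hγ
  set C' := Cc * C₀
  have hC'0 : 0 ≤ C' := mul_nonneg hCc.le hC₀0
  obtain ⟨Lf, hLf⟩ := LocallyLipschitzOn.exists_lipschitzOnWith_of_compact
    (isCompact_closedBall (0 : Fin n → ℝ) C) hf.locallyLipschitzOn
  set S := stripBall ω R C C'
  have hcont : ∀ U : C(AddCircle ω × unitInterval, ℝ),
      Continuous fun p : ℝ × ℝ => delaySource τ f g U p.1 p.2 := continuous_delaySource hfc hgc
  have hcont₁ : ∀ (U : C(AddCircle ω × unitInterval, ℝ)) (t : ℝ),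
      Continuous (delaySource τ f g U t) := fun U t => (hcont U).comp (Continuous.prodMk_right t)
  have hper : ∀ (U : C(AddCircle ω × unitInterval, ℝ)) (t : ℝ),
      delaySource τ f g U (t + ω) = delaySource τ f g U t := delaySource_add_period hgper
  have hInt : ∀ U ∈ S, ∀ t : ℝ,
      ∫ y in (0 : ℝ)..1, delaySource τ f g U t y ^ 2 ≤ efkEig γ 0 ^ 2 * R := fun U hU =>
    integral_delaySource_sq_le hfc hgc hβ hB hH1 hl hU.1
  have hcoef : ∀ U ∈ S, ∀ t k, |sineCoeff (delaySource τ f g U t) k| ≤ C₀ := fun U hU t k =>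
    abs_sineCoeff_le_of_integral_sq_le (hcont₁ U t) (hInt U hU t) k
  have hex : ∀ U ∈ S, ∃ V : C(AddCircle ω × unitInterval, ℝ), ∀ (t : ℝ) (x : unitInterval),
      V (t, x) = efkSol γ (delaySource τ f g U) t x := fun U hU =>
    exists_continuousMap_of_periodic (continuous_efkSol hγ (hcont U) (hcoef U hU))
      (efkSol_periodic (hper U))
  choose! Φ hΦ using hex
  have hΦs : ∀ U ∈ S, ∀ t, ∀ x ∈ Icc (0 : ℝ) 1,
      stripExtend (Φ U) t x = efkSol γ (delaySource τ f g U) t x := fun U hU t x hx => by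
    rw [stripExtend, projIcc_of_mem zero_le_one hx, hΦ U hU]
  have hmaps : MapsTo Φ S S := fun U hU => by
    refine ⟨fun t => ?_, ?_, fun t t' x x' => ?_⟩
    · refine le_of_eq_of_le (intervalIntegral.integral_congr fun y hy => ?_)
        (integral_efkSol_sq_le hγ (hcont U) (hInt U hU) t)
      rw [uIcc_of_le zero_le_one] at hy
      simp only [hΦs U hU t y hy]
    · rintro ⟨a, x⟩
      obtain ⟨t, rfl⟩ := QuotientAddGroup.mk_surjective a
      rw [hΦ U hU t x]
      exact abs_efkSol_le hγ (hcoef U hU) t x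
    · rw [hΦ U hU, hΦ U hU]
      exact hHolder _ _ (hcont U) (hcoef U hU) t x t' x'
  have hΦc : ContinuousOn Φ S := by
    refine LipschitzOnWith.continuousOn (K := (2 * Lf * T).toNNReal)
      (LipschitzOnWith.of_dist_le_mul fun U hU V hV => ?_)
    rw [coe_toNNReal _ (by positivity)]
    refine (ContinuousMap.dist_le (by positivity)).2 ?_
    rintro ⟨a, x⟩
    obtain ⟨t, rfl⟩ := QuotientAddGroup.mk_surjective a
    rw [hΦ U hU t x, hΦ V hV t x, Real.dist_eq]
    refine (abs_efkSol_sub_le hγ (hcont U) (hcont V) (hcoef U hU) (hcoef V hV)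
      (d := 2 * (Lf * dist U V)) (fun t k => ?_) t x).trans_eq (by ring)
    rw [← sineCoeff_sub (hcont₁ U t) (hcont₁ V t)]
    exact abs_sineCoeff_le (fun y _ => abs_delaySource_sub_le hLf hU.2.1 hV.2.1 t y) k
  have h0 : (0 : C(AddCircle ω × unitInterval, ℝ)) ∈ S := by
    refine ⟨fun t => ?_, fun y => ?_, fun t t' x x' => ?_⟩
    · simpa [stripExtend] using hR0
    · simpa using hC0
    · simp only [ContinuousMap.zero_apply, sub_self, abs_zero]
      positivity
  obtain ⟨U, hU, hfix⟩ := ContinuousMap.exists_fixedPoint_of_isCompact_of_convex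
    (isCompact_stripBall R C C') (convex_stripBall R C C') ⟨0, h0⟩ hΦc hmaps
  refine ⟨R, C, C', hC'0, U, hU, fun t x hx => ?_⟩
  rw [← hΦs U hU t x hx, hfix]

/-- Theorem 1.1: existence of a time `ω`-periodic classical solution of the delayed
extended Fisher–Kolmogorov equation under conditions (H1) and (H2). -/
theorem efk_periodic_classical_solution_exists
    (γ ω : ℝ) (hγ : 0 < γ) (hω : 0 < ω) (n : ℕ) (hn : 1 ≤ n)
    (τ : Fin n → ℝ) (hτ : ∀ k, 0 < τ k)
    (f : (Fin n → ℝ) → ℝ) (hf : LocallyLipschitz f)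
    (g : ℝ → ℝ → ℝ)
    (hg : ∃ L > (0:ℝ), ∃ θ : ℝ, 0 < θ ∧ θ ≤ 1 ∧
      ∀ t : ℝ, ∀ x ∈ Icc (0:ℝ) 1, ∀ s : ℝ, ∀ y ∈ Icc (0:ℝ) 1,
        |g t x - g s y| ≤ L * (|t - s| + |x - y|) ^ θ)
    (hgper : ∀ t : ℝ, ∀ x ∈ Icc (0:ℝ) 1, g (t + ω) x = g t x)
    (β : Fin n → ℝ) (hβ : ∀ k, 0 < β k) (K : ℝ) (hK : 0 < K)
    (hH1 : ∀ t : ℝ, ∀ x ∈ Icc (0:ℝ) 1, ∀ ξ : Fin n → ℝ,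
      |f ξ + g t x| ≤ ∑ k, β k * |ξ k| + K)
    (hH2 : ∑ k, β k < γ * π ^ 4 + π ^ 2 - 1) :
    ∃ u : ℝ → ℝ → ℝ, IsPeriodicClassicalSolution γ ω τ f g u := by
  have : Fact (0 < ω) := ⟨hω⟩
  have : Nonempty (Fin n) := ⟨⟨0, hn⟩⟩
  obtain ⟨L, hL, θ, hθ, -, hgH⟩ := hg
  have hgc := continuous_projIcc_of_hoelder hθ hgH
  obtain ⟨R, C, C', hC', U, hU, hfix⟩ := exists_stripExtend_eq_efkSol (τ := τ) hγ hω hf hgc hgper hβ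
    (Finset.sum_pos (fun k _ => hβ k) Finset.univ_nonempty) hH1 (by simpa [efkEig] using hH2)
  obtain ⟨Lf, hLf⟩ := LocallyLipschitzOn.exists_lipschitzOnWith_of_compact
    (isCompact_closedBall (0 : Fin n → ℝ) C) hf.locallyLipschitzOn
  have hM : ∀ t x, |delaySource τ f g U t x| ≤ ∑ k, β k * C + K := fun t x => by
    rw [delaySource, add_comm]
    refine (hH1 t _ (projIcc (0 : ℝ) 1 zero_le_one x).2 _).trans ?_
    gcongr with k
    · exact (hβ k).le
    · exact hU.2.1 _
  obtain ⟨L', hL', θ', hθ', hθ'1, hH⟩ := exists_hoelder_delaySource hL hθ hgH hC' hLf hU hM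
  refine ⟨_, isPeriodicClassicalSolution_efkSol hγ
    (continuous_delaySource hf.continuous hgc U) hM hL' hθ' hθ'1 hH (delaySource_add_period hgper U)
    fun t x hx => ?_⟩
  have hx' := Ioo_subset_Icc_self hx
  rw [delaySource, projIcc_of_mem zero_le_one hx']
  congr 2
  funext k
  exact hfix _ x hx'
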